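/- arXiv:2202.07696 — 3 statements merged into one kernel-verified Lean document; each statement's English description precedes it below -/
import Mathlib

section
/- Let K be a field, R = K[x_1,...,x_n], d a positive integer, α: R → R the K-algebra map with α(x_i) = x_i^d, and I a homogeneous ideal with I' = α(I)R. If the inequality reg(I) ≤ reg(I')/d is an equality, then d = 1 or I is a principal ideal. -/
open MvPolynomial

variable {K : Type} [Field K]

/-- The degree-`k` homogeneous component of a homogeneous ideal `I`,
as a `K`-vector subspace of the polynomial ring (zero in negative degrees). -/
noncomputable def idealPiece {n : ℕ} (I : Ideal (MvPolynomial (Fin n) K)) (k : ℤ) :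
    Submodule K (MvPolynomial (Fin n) K) :=
  if 0 ≤ k then
    (Submodule.restrictScalars K (I : Submodule (MvPolynomial (Fin n) K) (MvPolynomial (Fin n) K)))
      ⊓ (homogeneousSubmodule (Fin n) K k.toNat)
  else ⊥

lemma mul_X_mem_idealPiece {n : ℕ} (I : Ideal (MvPolynomial (Fin n) K)) (t : Fin n) (k : ℤ)
    {x : MvPolynomial (Fin n) K} (hx : x ∈ idealPiece I k) :
    (X t : MvPolynomial (Fin n) K) * x ∈ idealPiece I (k + 1) := by
  by_cases h : 0 ≤ k
  · rw [idealPiece, if_pos h] at hx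
    rw [idealPiece, if_pos (by omega)]
    refine ⟨I.mul_mem_left _ hx.1, ?_⟩
    rw [Submodule.mem_inf] at hx
    have hh : x.IsHomogeneous k.toNat := (mem_homogeneousSubmodule _ _).1 hx.2
    have : ((X t : MvPolynomial (Fin n) K) * x).IsHomogeneous (1 + k.toNat) :=
      (isHomogeneous_X K t).mul hh
    have he : (k + 1).toNat = 1 + k.toNat := by omega
    exact (mem_homogeneousSubmodule _ _).2 (he ▸ this)
  · rw [idealPiece, if_neg h, Submodule.mem_bot] at hx
    rw [hx, mul_zero]
    exact Submodule.zero_mem _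

/-- Multiplication by the variable `X t` as a linear map between graded pieces. -/
noncomputable def mulXPiece {n : ℕ} (I : Ideal (MvPolynomial (Fin n) K)) (t : Fin n) (k : ℤ) :
    idealPiece I k →ₗ[K] idealPiece I (k + 1) :=
  (LinearMap.mulLeft K (X t)).restrict (fun _ hx => mul_X_mem_idealPiece I t k hx)

/-- Index set of the `i`-th term of the Koszul complex: subsets of the variables of size `i`. -/
abbrev KoszulIdx (n i : ℕ) := {s : Finset (Fin n) // s.card = i}

/-- The Koszul differential (in internal degree `j`) of the complex computing
`Tor(I, K)`, from homological degree `i+1` to homological degree `i`. -/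
noncomputable def koszulDiff {n : ℕ} (I : Ideal (MvPolynomial (Fin n) K)) (i : ℕ) (j : ℤ) :
    ((KoszulIdx n (i + 1)) → idealPiece I (j - (i + 1 : ℕ)))
      →ₗ[K] ((KoszulIdx n i) → idealPiece I (j - (i : ℕ))) :=
  ∑ s' : KoszulIdx n (i + 1), ∑ t ∈ (s' : Finset (Fin n)).attach,
    ((-1 : K) ^ (((s' : Finset (Fin n)).filter (fun u => u < t.1)).card)) •
      ((LinearMap.single (R := K) (φ := fun _ : KoszulIdx n i => idealPiece I (j - (i : ℕ)))
          ⟨(s' : Finset (Fin n)).erase t.1, by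
            rw [Finset.card_erase_of_mem t.2, s'.2]; rfl⟩) ∘ₗ
        (LinearEquiv.ofEq _ _ (by rw [show j - ((i : ℕ) + 1 : ℕ) + 1 = j - (i : ℕ) by push_cast; ring])).toLinearMap ∘ₗ
        (mulXPiece I t.1 (j - ((i : ℕ) + 1 : ℕ))) ∘ₗ
        (LinearMap.proj s'))

/-- Cycles of the Koszul complex at homological degree `i`, internal degree `j`. -/
noncomputable def koszulCycles {n : ℕ} (I : Ideal (MvPolynomial (Fin n) K)) :
    (i : ℕ) → (j : ℤ) → Submodule K ((KoszulIdx n i) → idealPiece I (j - (i : ℕ)))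
  | 0, _ => ⊤
  | (i + 1), j => LinearMap.ker (koszulDiff I i j)

set_option synthInstance.maxHeartbeats 1000000 in
set_option maxHeartbeats 1000000 in
/-- The graded Betti number `β_{i,j}(I) = dim_K Tor_i(I, K)_j`, computed as the dimension
of the homology of the Koszul complex (all spaces involved are finite-dimensional, so the
dimension of the homology `Z/B` is `dim Z - dim (B ⊓ Z)`). -/
noncomputable def gradedBetti {n : ℕ} (I : Ideal (MvPolynomial (Fin n) K)) (i : ℕ) (j : ℤ) : ℕ :=
  Module.finrank K ↥(koszulCycles I i j) -
    Module.finrank K ↥(LinearMap.range (koszulDiff I i j) ⊓ koszulCycles I i j)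

/-- The Castelnuovo–Mumford regularity `reg(I) = max { j - i : β_{i,j}(I) ≠ 0 }`. -/
noncomputable def reg {n : ℕ} (I : Ideal (MvPolynomial (Fin n) K)) : ℤ :=
  sSup {r : ℤ | ∃ (i : ℕ) (j : ℤ), gradedBetti I i j ≠ 0 ∧ r = j - i}

/-- `t_i(I) = max { j : β_{i,j}(I) ≠ 0 }`, the maximal shift in homological degree `i`. -/
noncomputable def maxShift {n : ℕ} (I : Ideal (MvPolynomial (Fin n) K)) (i : ℕ) : ℤ :=
  sSup {j : ℤ | gradedBetti I i j ≠ 0}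

/-- The projective dimension of `I`. -/
noncomputable def projdim {n : ℕ} (I : Ideal (MvPolynomial (Fin n) K)) : ℕ :=
  sSup {i : ℕ | ∃ j : ℤ, gradedBetti I i j ≠ 0}

/-- An ideal of a polynomial ring is homogeneous (for the standard grading) if it contains
all homogeneous components of its elements. -/
def IsHomogeneousIdeal {n : ℕ} (I : Ideal (MvPolynomial (Fin n) K)) : Prop :=
  ∀ f ∈ I, ∀ k : ℕ, homogeneousComponent k f ∈ I

lemma mem_idealPiece_iff {n : ℕ} {I : Ideal (MvPolynomial (Fin n) K)} {k : ℤ}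
    {f : MvPolynomial (Fin n) K} :
    f ∈ idealPiece I k ↔ f ∈ I ∧ ∀ m, coeff m f ≠ 0 → (m.degree : ℤ) = k := by
  unfold idealPiece
  split_ifs with h
  · rw [Submodule.mem_inf, Submodule.restrictScalars_mem, mem_homogeneousSubmodule]
    refine and_congr Iff.rfl ⟨fun hf m hm => ?_, fun hf m hm => ?_⟩
    · by_contra hne
      exact hm (hf.coeff_eq_zero (by omega))
    · have := hf m hm
      have hw : Finsupp.weight (1 : Fin n → ℕ) m = m.degree :=
        (DFunLike.congr_fun (Finsupp.degree_eq_weight_one (R := ℕ)) m).symm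
      omega
  · rw [Submodule.mem_bot]
    refine ⟨?_, fun hf => ?_⟩
    · rintro rfl
      simp
    · ext m
      by_contra hm
      have := hf.2 m (by simpa using hm)
      omega

instance finiteDimensional_idealPiece {n : ℕ} (I : Ideal (MvPolynomial (Fin n) K)) (k : ℤ) :
    FiniteDimensional K (idealPiece I k) := by
  have hfin : FiniteDimensional K (homogeneousSubmodule (Fin n) K k.toNat) :=
    Module.Finite.iff_fg.mpr (homogeneousSubmodule_fg _ K k.toNat)
  refine Submodule.finiteDimensional_of_le (S₂ := homogeneousSubmodule (Fin n) K k.toNat) ?_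
  unfold idealPiece
  split_ifs with h
  · exact inf_le_right
  · exact bot_le

/-- The Koszul sign of `t` relative to `s`. -/
noncomputable def koszulSign (K : Type) [Field K] {n : ℕ} (t : Fin n) (s : Finset (Fin n)) :
    MvPolynomial (Fin n) K :=
  (-1) ^ (s.filter (fun u => u < t)).card

/-- The differential of the full Koszul complex on the variables, with chains viewed as
functions on all finite sets of variables. -/
noncomputable def fullKoszulDiff (K : Type) [Field K] (n : ℕ) :
    (Finset (Fin n) → MvPolynomial (Fin n) K) →ₗ[MvPolynomial (Fin n) K]
      (Finset (Fin n) → MvPolynomial (Fin n) K) where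
  toFun z s := ∑ t ∈ sᶜ, koszulSign K t s * (X t * z (insert t s))
  map_add' x y := by
    ext1 s
    simp [mul_add, Finset.sum_add_distrib]
  map_smul' a x := by
    ext1 s
    simp only [Pi.smul_apply, smul_eq_mul, RingHom.id_apply, Finset.mul_sum]
    exact Finset.sum_congr rfl fun t _ => by ring

lemma fullKoszulDiff_apply {n : ℕ} (z : Finset (Fin n) → MvPolynomial (Fin n) K)
    (s : Finset (Fin n)) :
    fullKoszulDiff K n z s = ∑ t ∈ sᶜ, koszulSign K t s * (X t * z (insert t s)) := rfl

/-- The Koszul chains of homological degree `i` with coefficients in `I` of degree `k`. -/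
def IsKoszulChain {n : ℕ} (I : Ideal (MvPolynomial (Fin n) K)) (i : ℕ) (k : ℤ)
    (z : Finset (Fin n) → MvPolynomial (Fin n) K) : Prop :=
  (∀ s, s.card = i → z s ∈ idealPiece I k) ∧ ∀ s, s.card ≠ i → z s = 0

lemma IsKoszulChain.mem {n : ℕ} {I : Ideal (MvPolynomial (Fin n) K)} {i : ℕ} {k : ℤ}
    {z : Finset (Fin n) → MvPolynomial (Fin n) K} (hz : IsKoszulChain I i k z)
    (s : Finset (Fin n)) : z s ∈ idealPiece I k := by
  by_cases h : s.card = i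
  · exact hz.1 s h
  · rw [hz.2 s h]
    exact Submodule.zero_mem _

/-- Extension by zero of a family of coefficients to all finite sets of variables. -/
noncomputable def extendChain {n : ℕ} {I : Ideal (MvPolynomial (Fin n) K)} {i : ℕ} {k : ℤ}
    (z : KoszulIdx n i → idealPiece I k) : Finset (Fin n) → MvPolynomial (Fin n) K :=
  fun s => if h : s.card = i then (z ⟨s, h⟩ : MvPolynomial (Fin n) K) else 0

lemma extendChain_coe {n : ℕ} {I : Ideal (MvPolynomial (Fin n) K)} {i : ℕ} {k : ℤ}
    (z : KoszulIdx n i → idealPiece I k) (s : KoszulIdx n i) :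
    extendChain z s = z s := by
  simp [extendChain, s.2]

lemma extendChain_of_card_ne {n : ℕ} {I : Ideal (MvPolynomial (Fin n) K)} {i : ℕ} {k : ℤ}
    (z : KoszulIdx n i → idealPiece I k) {s : Finset (Fin n)} (h : s.card ≠ i) :
    extendChain z s = 0 := by
  simp [extendChain, h]

lemma extendChain_injective {n : ℕ} {I : Ideal (MvPolynomial (Fin n) K)} {i : ℕ} {k : ℤ} :
    Function.Injective (extendChain : (KoszulIdx n i → idealPiece I k) → _) := by
  intro z w h
  ext1 s
  apply Subtype.ext
  rw [← extendChain_coe, ← extendChain_coe, h]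

lemma isKoszulChain_extendChain {n : ℕ} {I : Ideal (MvPolynomial (Fin n) K)} {i : ℕ} {k : ℤ}
    (z : KoszulIdx n i → idealPiece I k) : IsKoszulChain I i k (extendChain z) := by
  refine ⟨fun s h => ?_, fun s h => extendChain_of_card_ne z h⟩
  simp [extendChain, h]

lemma IsKoszulChain.exists_extendChain {n : ℕ} {I : Ideal (MvPolynomial (Fin n) K)} {i : ℕ}
    {k : ℤ} {z : Finset (Fin n) → MvPolynomial (Fin n) K} (hz : IsKoszulChain I i k z) :
    ∃ y : KoszulIdx n i → idealPiece I k, extendChain y = z := by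
  refine ⟨fun s => ⟨z s, hz.1 s s.2⟩, funext fun s => ?_⟩
  by_cases h : s.card = i
  · simp [extendChain, h]
  · simp [extendChain, h, hz.2 s h]

lemma koszulDiff_apply_coe {n : ℕ} (I : Ideal (MvPolynomial (Fin n) K)) (i : ℕ) (j : ℤ)
    (w : KoszulIdx n (i + 1) → idealPiece I (j - (i + 1 : ℕ))) (s : KoszulIdx n i) :
    (koszulDiff I i j w s : MvPolynomial (Fin n) K) =
      ∑ s' : KoszulIdx n (i + 1), ∑ t ∈ (s' : Finset (Fin n)).attach,
        if (s : Finset (Fin n)) = (s' : Finset (Fin n)).erase t.1 then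
          koszulSign K t.1 (s' : Finset (Fin n)) * (X t.1 * (w s' : MvPolynomial (Fin n) K))
        else 0 := by
  unfold koszulDiff
  simp only [LinearMap.sum_apply, Finset.sum_apply, Submodule.coe_sum]
  refine Finset.sum_congr rfl fun s' _ => Finset.sum_congr rfl fun t _ => ?_
  simp only [LinearMap.smul_apply, LinearMap.comp_apply, Pi.smul_apply, LinearMap.coe_single,
    Submodule.coe_smul, LinearMap.proj_apply]
  split_ifs with h
  · obtain ⟨s, hs⟩ := s
    subst h
    rw [Pi.single_eq_same]
    rw [koszulSign, MvPolynomial.smul_eq_C_mul, map_pow, map_neg, map_one]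
    rfl
  · rw [Pi.single_eq_of_ne (fun h' => h (congrArg Subtype.val h'))]
    simp

lemma koszulSign_insert_self {n : ℕ} (t : Fin n) (s : Finset (Fin n)) :
    koszulSign K t (insert t s) = koszulSign K t s := by
  rw [koszulSign, koszulSign, Finset.filter_insert, if_neg (lt_irrefl t)]

lemma extendChain_koszulDiff {n : ℕ} (I : Ideal (MvPolynomial (Fin n) K)) (i : ℕ) (j : ℤ)
    (w : KoszulIdx n (i + 1) → idealPiece I (j - (i + 1 : ℕ))) :
    extendChain (koszulDiff I i j w) = fullKoszulDiff K n (extendChain w) := by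
  ext1 s
  rw [fullKoszulDiff_apply]
  by_cases h : s.card = i
  · have : extendChain (koszulDiff I i j w) s = (koszulDiff I i j w ⟨s, h⟩) :=
      extendChain_coe _ ⟨s, h⟩
    rw [this, koszulDiff_apply_coe, Finset.sum_sigma', ← Finset.sum_filter]
    refine Finset.sum_bij' (fun p _ => p.2.1)
      (fun t ht => ⟨⟨insert t s, by
        rw [Finset.card_insert_of_notMem (Finset.mem_compl.1 ht), h]⟩,
        ⟨t, Finset.mem_insert_self t s⟩⟩) ?_ ?_ ?_ ?_ ?_
    · rintro ⟨⟨s', hs'⟩, ⟨t, ht⟩⟩ hp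
      simp only [Finset.mem_filter] at hp
      simp [hp.2]
    · intro t ht
      simp [Finset.erase_insert (Finset.mem_compl.1 ht)]
    · rintro ⟨⟨s', hs'⟩, ⟨t, ht⟩⟩ hp
      simp only [Finset.mem_filter] at hp
      obtain ⟨-, rfl⟩ := hp
      have hi : insert t (s'.erase t) = s' := Finset.insert_erase ht
      congr 1
      · exact Subtype.ext hi
      · congr!
    · intro t ht
      rfl
    · rintro ⟨⟨s', hs'⟩, ⟨t, ht⟩⟩ hp
      simp only [Finset.mem_filter] at hp
      obtain ⟨-, rfl⟩ := hp
      have hi : insert t (s'.erase t) = s' := Finset.insert_erase ht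
      simp only
      rw [← koszulSign_insert_self t (s'.erase t), hi]
      rw [show extendChain w s' = w ⟨s', hs'⟩ from extendChain_coe w ⟨s', hs'⟩]
  · rw [extendChain_of_card_ne _ h]
    refine (Finset.sum_eq_zero fun t ht => ?_).symm
    rw [extendChain_of_card_ne]
    · simp
    · rw [Finset.card_insert_of_notMem (Finset.mem_compl.1 ht)]
      omega

lemma mem_koszulCycles_iff {n : ℕ} (I : Ideal (MvPolynomial (Fin n) K)) (i : ℕ) (j : ℤ)
    (z : KoszulIdx n i → idealPiece I (j - (i : ℕ))) :
    z ∈ koszulCycles I i j ↔ fullKoszulDiff K n (extendChain z) = 0 := by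
  cases i with
  | zero =>
    refine ⟨fun _ => funext fun s => ?_, fun _ => Submodule.mem_top⟩
    rw [fullKoszulDiff_apply]
    refine Finset.sum_eq_zero fun t ht => ?_
    rw [extendChain_of_card_ne]
    · simp
    · simp
  | succ i =>
    have h0 : extendChain (0 : KoszulIdx n i → idealPiece I (j - (i : ℕ))) = 0 := by
      ext1 s
      simp [extendChain]
    rw [← extendChain_koszulDiff, ← h0, extendChain_injective.eq_iff]
    exact LinearMap.mem_ker

lemma gradedBetti_ne_zero_iff {n : ℕ} (I : Ideal (MvPolynomial (Fin n) K)) (i : ℕ) (j : ℤ) :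
    gradedBetti I i j ≠ 0 ↔ ∃ z, IsKoszulChain I i (j - i) z ∧ fullKoszulDiff K n z = 0 ∧
      ∀ w, IsKoszulChain I (i + 1) (j - (i + 1 : ℕ)) w → fullKoszulDiff K n w ≠ z := by
  have key : gradedBetti I i j ≠ 0 ↔ ¬ koszulCycles I i j ≤ LinearMap.range (koszulDiff I i j) := by
    rw [gradedBetti, not_iff_not]
    constructor
    · intro h
      have hle := Submodule.finrank_mono
        (inf_le_right : LinearMap.range (koszulDiff I i j) ⊓ koszulCycles I i j ≤ _)
      have := Submodule.eq_of_le_of_finrank_eq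
        (inf_le_right : LinearMap.range (koszulDiff I i j) ⊓ koszulCycles I i j ≤ _) (by omega)
      exact inf_eq_right.1 this
    · intro h
      rw [inf_eq_right.2 h, Nat.sub_self]
  rw [key, SetLike.not_le_iff_exists]
  constructor
  · rintro ⟨z, hz, hz'⟩
    refine ⟨extendChain z, isKoszulChain_extendChain z, (mem_koszulCycles_iff I i j z).1 hz,
      fun w hw h => hz' ?_⟩
    obtain ⟨w, rfl⟩ := hw.exists_extendChain
    rw [← extendChain_koszulDiff] at h
    exact ⟨w, extendChain_injective h⟩
  · rintro ⟨z, hz, hz0, hz'⟩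
    obtain ⟨z, rfl⟩ := hz.exists_extendChain
    refine ⟨z, (mem_koszulCycles_iff I i j z).2 hz0, ?_⟩
    rintro ⟨w, rfl⟩
    exact hz' _ (isKoszulChain_extendChain w) (extendChain_koszulDiff I i j w).symm

lemma koszulSign_mul_self {n : ℕ} (t : Fin n) (s : Finset (Fin n)) :
    koszulSign K t s * koszulSign K t s = 1 := by
  rw [koszulSign, ← pow_add, ← two_mul, pow_mul, neg_one_sq, one_pow]

lemma koszulSign_insert {n : ℕ} {t v : Fin n} {s : Finset (Fin n)} (hv : v ∉ s) :
    koszulSign K t (insert v s) = (if v < t then -1 else 1) * koszulSign K t s := by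
  unfold koszulSign
  rw [Finset.filter_insert]
  split_ifs with h
  · rw [Finset.card_insert_of_notMem (by simp [hv]), pow_succ']
  · rw [one_mul]

/-- Left exterior multiplication by the basis element of the variable `t`. -/
noncomputable def koszulWedge {n : ℕ} (t : Fin n)
    (z : Finset (Fin n) → MvPolynomial (Fin n) K) (s : Finset (Fin n)) :
    MvPolynomial (Fin n) K :=
  if t ∈ s then koszulSign K t s * z (s.erase t) else 0

lemma fullKoszulDiff_koszulWedge {n : ℕ} (t : Fin n)
    (z : Finset (Fin n) → MvPolynomial (Fin n) K) (hz : fullKoszulDiff K n z = 0) :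
    fullKoszulDiff K n (koszulWedge t z) = (X t : MvPolynomial (Fin n) K) • z := by
  ext1 s
  rw [fullKoszulDiff_apply, Pi.smul_apply, smul_eq_mul]
  by_cases ht : t ∈ s
  · obtain ⟨s, hts, rfl⟩ : ∃ s', t ∉ s' ∧ insert t s' = s :=
      ⟨s.erase t, Finset.notMem_erase t s, Finset.insert_erase ht⟩
    have h0 : ∑ v ∈ sᶜ, koszulSign K v s * (X v * z (insert v s)) = 0 := congrFun hz s
    have hc : sᶜ = insert t (insert t s)ᶜ := by
      ext v
      by_cases hvt : v = t
      · simp [hvt, hts]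
      · simp [hvt]
    rw [hc, Finset.sum_insert (by simp)] at h0
    have h1 : ∀ v ∈ (insert t s)ᶜ, koszulSign K v (insert t s) *
        (X v * koszulWedge t z (insert v (insert t s))) =
        - koszulSign K t s * (koszulSign K v s * (X v * z (insert v s))) := by
      intro v hv
      simp only [Finset.mem_compl, Finset.mem_insert, not_or] at hv
      obtain ⟨hvt, hvs⟩ := hv
      have he : (insert v (insert t s)).erase t = insert v s := by
        rw [Finset.insert_comm, Finset.erase_insert]
        simp [Ne.symm hvt, hts]
      rw [koszulWedge, if_pos (by simp), he, koszulSign_insert hts,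
        koszulSign_insert (by simp [hvt, hvs]), koszulSign_insert_self]
      rcases lt_or_gt_of_ne hvt with h | h
      · rw [if_pos h, if_neg h.not_gt]
        ring
      · rw [if_neg h.not_gt, if_pos h]
        ring
    rw [Finset.sum_congr rfl h1, ← Finset.mul_sum, eq_neg_of_add_eq_zero_right h0]
    calc _ = (koszulSign K t s * koszulSign K t s) * (X t * z (insert t s)) := by ring
      _ = _ := by rw [koszulSign_mul_self, one_mul]
  · rw [Finset.sum_eq_single t]
    · rw [koszulWedge, if_pos (Finset.mem_insert_self t s), Finset.erase_insert ht,
        koszulSign_insert_self]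
      calc _ = (koszulSign K t s * koszulSign K t s) * (X t * z s) := by ring
        _ = _ := by rw [koszulSign_mul_self, one_mul]
    · intro v _ hvt
      rw [koszulWedge, if_neg (by simp [Ne.symm hvt, ht])]
      simp
    · intro h
      exact absurd (Finset.mem_compl.2 ht) h

lemma fullKoszulDiff_empty {n : ℕ} (z : Finset (Fin n) → MvPolynomial (Fin n) K) :
    fullKoszulDiff K n z ∅ = ∑ t, X t * z {t} := by
  rw [fullKoszulDiff_apply]
  simp [koszulSign]

lemma sum_X_mul_fullKoszulDiff_singleton {n : ℕ}
    (p : Finset (Fin n) → MvPolynomial (Fin n) K) :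
    ∑ t, X t * fullKoszulDiff K n p {t} = 0 := by
  simp only [fullKoszulDiff_apply, Finset.mul_sum]
  rw [Finset.sum_sigma']
  refine Finset.sum_involution (fun a _ => ⟨a.2, a.1⟩) ?_ ?_ ?_ ?_
  · rintro ⟨a, b⟩ h
    have hne : b ≠ a := by simpa using h
    simp only [koszulSign, Finset.filter_singleton, Finset.pair_comm a b]
    rcases lt_or_gt_of_ne hne with h | h
    · simp [h, h.not_gt]
      ring
    · simp [h, h.not_gt]
      ring
  · rintro ⟨a, b⟩ h _ h'
    have hne : b ≠ a := by simpa using h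
    simp only [Sigma.mk.injEq] at h'
    exact hne h'.1
  · rintro ⟨a, b⟩ h
    simpa [eq_comm] using h
  · rintro ⟨a, b⟩ h
    rfl

lemma X_mul_mem_idealPiece_of_sub_one {n : ℕ} {I : Ideal (MvPolynomial (Fin n) K)} (t : Fin n)
    {k : ℤ} {x : MvPolynomial (Fin n) K} (hx : x ∈ idealPiece I (k - 1)) :
    X t * x ∈ idealPiece I k := by
  simpa using mul_X_mem_idealPiece I t (k - 1) hx

lemma koszulSign_mul_mem {n : ℕ} (S : Submodule K (MvPolynomial (Fin n) K)) (t : Fin n)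
    (s : Finset (Fin n)) {x : MvPolynomial (Fin n) K} (hx : x ∈ S) :
    koszulSign K t s * x ∈ S := by
  rw [koszulSign]
  rcases neg_one_pow_eq_or (MvPolynomial (Fin n) K) (s.filter (fun u => u < t)).card with h | h
  · simpa [h] using hx
  · simpa [h] using hx

lemma fullKoszulDiff_mem_idealPiece {n : ℕ} {I : Ideal (MvPolynomial (Fin n) K)} {k : ℤ}
    {z : Finset (Fin n) → MvPolynomial (Fin n) K} (hz : ∀ s, z s ∈ idealPiece I (k - 1))
    (s : Finset (Fin n)) : fullKoszulDiff K n z s ∈ idealPiece I k := by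
  rw [fullKoszulDiff_apply]
  exact Submodule.sum_mem _ fun t _ =>
    koszulSign_mul_mem _ _ _ (X_mul_mem_idealPiece_of_sub_one t (hz _))

lemma fullKoszulDiff_mem {n : ℕ} {I : Ideal (MvPolynomial (Fin n) K)}
    {z : Finset (Fin n) → MvPolynomial (Fin n) K} (hz : ∀ s, z s ∈ I)
    (s : Finset (Fin n)) : fullKoszulDiff K n z s ∈ I := by
  rw [fullKoszulDiff_apply]
  exact Submodule.sum_mem _ fun t _ => I.mul_mem_left _ (I.mul_mem_left _ (hz _))

lemma IsKoszulChain.koszulWedge {n : ℕ} {I : Ideal (MvPolynomial (Fin n) K)} {i : ℕ} {k : ℤ}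
    {z : Finset (Fin n) → MvPolynomial (Fin n) K} (hz : IsKoszulChain I i k z) (t : Fin n) :
    IsKoszulChain I (i + 1) k (koszulWedge t z) := by
  refine ⟨fun s _ => ?_, fun s hs => ?_⟩
  · unfold _root_.koszulWedge
    split_ifs
    · exact koszulSign_mul_mem _ _ _ (hz.mem _)
    · exact Submodule.zero_mem _
  · unfold _root_.koszulWedge
    split_ifs with h
    · have := Finset.card_erase_add_one h
      rw [hz.2 _ (by omega), mul_zero]
    · rfl

lemma IsKoszulChain.sum {n : ℕ} {I : Ideal (MvPolynomial (Fin n) K)} {i : ℕ} {k : ℤ}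
    {ι : Type} (A : Finset ι) {z : ι → Finset (Fin n) → MvPolynomial (Fin n) K}
    (hz : ∀ a ∈ A, IsKoszulChain I i k (z a)) : IsKoszulChain I i k (∑ a ∈ A, z a) := by
  refine ⟨fun s hs => ?_, fun s hs => ?_⟩
  · rw [Finset.sum_apply]
    exact Submodule.sum_mem _ fun a ha => (hz a ha).1 s hs
  · rw [Finset.sum_apply]
    exact Finset.sum_eq_zero fun a ha => (hz a ha).2 s hs

/-- The `K`-algebra endomorphism raising every variable to its `d`-th power. -/
noncomputable abbrev powerMap (K : Type) [Field K] (n d : ℕ) :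
    MvPolynomial (Fin n) K →ₐ[K] MvPolynomial (Fin n) K :=
  aeval fun i => (X i : MvPolynomial (Fin n) K) ^ d

lemma powerMap_monomial {n : ℕ} (d : ℕ) (m : Fin n →₀ ℕ) (r : K) :
    powerMap K n d (monomial m r) = monomial (d • m) r := by
  rw [powerMap, aeval_monomial, monomial_eq (s := d • m), MvPolynomial.algebraMap_eq,
    Finsupp.prod_of_support_subset (d • m) Finsupp.support_smul _ (by simp)]
  simp [Finsupp.prod, pow_mul]

lemma coeff_powerMap_of_ne {n : ℕ} {d : ℕ} {f : MvPolynomial (Fin n) K} {m : Fin n →₀ ℕ}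
    (h : coeff m (powerMap K n d f) ≠ 0) : ∃ a, m = d • a ∧ coeff a f ≠ 0 := by
  rw [f.as_sum, map_sum, coeff_sum] at h
  obtain ⟨a, ha, hne⟩ := Finset.exists_ne_zero_of_sum_ne_zero h
  rw [powerMap_monomial, coeff_monomial] at hne
  refine ⟨a, ?_, by simpa using ha⟩
  by_contra hcon
  rw [if_neg (Ne.symm hcon)] at hne
  exact hne rfl

lemma smul_add_injective {n d : ℕ} (hd : 0 < d) (c : Fin n →₀ ℕ) :
    Function.Injective (fun a : Fin n →₀ ℕ => d • a + c) := by
  intro a b h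
  ext i
  have := DFunLike.congr_fun h i
  simp only [Finsupp.add_apply, Finsupp.smul_apply, smul_eq_mul, add_left_inj] at this
  exact Nat.eq_of_mul_eq_mul_left hd this

/-- The polynomial collecting the coefficients of `f` at the exponents `d • a + c`. -/
noncomputable def residuePart {n d : ℕ} (hd : 0 < d) (c : Fin n →₀ ℕ)
    (f : MvPolynomial (Fin n) K) : MvPolynomial (Fin n) K :=
  AddMonoidAlgebra.comapDomain (fun a => d • a + c) (smul_add_injective hd c) f

lemma coeff_residuePart {n d : ℕ} (hd : 0 < d) (c : Fin n →₀ ℕ)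
    (f : MvPolynomial (Fin n) K) (a : Fin n →₀ ℕ) :
    coeff a (residuePart hd c f) = coeff (d • a + c) f := rfl

lemma residuePart_add {n d : ℕ} (hd : 0 < d) (c : Fin n →₀ ℕ) (f g : MvPolynomial (Fin n) K) :
    residuePart hd c (f + g) = residuePart hd c f + residuePart hd c g := by
  ext a
  simp [coeff_residuePart]

lemma residuePart_zero {n d : ℕ} (hd : 0 < d) (c : Fin n →₀ ℕ) :
    residuePart hd c (0 : MvPolynomial (Fin n) K) = 0 := by
  ext a
  simp [coeff_residuePart]

lemma residuePart_sum {n d : ℕ} (hd : 0 < d) (c : Fin n →₀ ℕ) {ι : Type} (A : Finset ι)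
    (f : ι → MvPolynomial (Fin n) K) :
    residuePart hd c (∑ a ∈ A, f a) = ∑ a ∈ A, residuePart hd c (f a) := by
  ext a
  simp [coeff_residuePart, coeff_sum]

lemma residuePart_C_mul {n d : ℕ} (hd : 0 < d) (c : Fin n →₀ ℕ) (r : K)
    (f : MvPolynomial (Fin n) K) : residuePart hd c (C r * f) = C r * residuePart hd c f := by
  ext a
  simp [coeff_residuePart, coeff_C_mul]

lemma residuePart_koszulSign_mul {n d : ℕ} (hd : 0 < d) (c : Fin n →₀ ℕ) (t : Fin n)
    (s : Finset (Fin n)) (f : MvPolynomial (Fin n) K) :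
    residuePart hd c (koszulSign K t s * f) = koszulSign K t s * residuePart hd c f := by
  have h : koszulSign K t s = C ((-1) ^ (s.filter (fun u => u < t)).card) := by
    simp [koszulSign]
  rw [h, residuePart_C_mul]

lemma residuePart_X_mul {n d : ℕ} (hd : 0 < d) {c : Fin n →₀ ℕ} {t : Fin n} (hc : c t = 0)
    (f : MvPolynomial (Fin n) K) :
    residuePart hd c (X t * f) =
      X t * residuePart hd (c + Finsupp.single t (d - 1)) f := by
  ext a
  rw [coeff_residuePart, coeff_X_mul', coeff_X_mul']
  have hiff : t ∈ (d • a + c).support ↔ t ∈ a.support := by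
    simp [hc, hd.ne']
  simp only [hiff]
  split_ifs with h
  · rw [coeff_residuePart]
    congr 1
    ext i
    have ha : 1 ≤ a t := Nat.one_le_iff_ne_zero.2 (Finsupp.mem_support_iff.1 h)
    by_cases hi : i = t
    · subst hi
      obtain ⟨b, hb⟩ := Nat.exists_eq_add_of_le ha
      simp [hc, hb, mul_add]
      omega
    · simp [Ne.symm hi]
  · rfl

lemma residuePart_X_pow_mul {n d : ℕ} (hd : 0 < d) {c : Fin n →₀ ℕ} {t : Fin n} (hc : c t < d)
    (f : MvPolynomial (Fin n) K) :
    residuePart hd c (X t ^ d * f) = X t * residuePart hd c f := by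
  ext a
  rw [coeff_residuePart, X_pow_eq_monomial, coeff_monomial_mul', coeff_X_mul', one_mul]
  have hiff : Finsupp.single t d ≤ d • a + c ↔ t ∈ a.support := by
    rw [Finsupp.single_le_iff, Finsupp.mem_support_iff]
    simp only [Finsupp.add_apply, Finsupp.smul_apply, smul_eq_mul]
    constructor
    · rintro h h0
      rw [h0] at h
      omega
    · intro h
      exact le_add_right (Nat.le_mul_of_pos_right d (Nat.pos_of_ne_zero h))
  simp only [hiff]
  split_ifs with h
  · rw [coeff_residuePart]
    congr 1
    ext i
    have ha : 1 ≤ a t := Nat.one_le_iff_ne_zero.2 (Finsupp.mem_support_iff.1 h)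
    by_cases hi : i = t
    · subst hi
      obtain ⟨b, hb⟩ := Nat.exists_eq_add_of_le ha
      simp [hb, mul_add]
      omega
    · simp [Ne.symm hi]
  · rfl

lemma residuePart_powerMap_mul {n d : ℕ} (hd : 0 < d) {c : Fin n →₀ ℕ} (hc : ∀ t, c t < d)
    (f g : MvPolynomial (Fin n) K) :
    residuePart hd c (powerMap K n d f * g) = f * residuePart hd c g := by
  induction f using MvPolynomial.induction_on generalizing g with
  | C r => rw [powerMap, aeval_C, MvPolynomial.algebraMap_eq, residuePart_C_mul]
  | add p q hp hq => rw [map_add, add_mul, residuePart_add, hp, hq, add_mul]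
  | mul_X p t hp =>
    rw [map_mul, mul_assoc, hp, powerMap, aeval_X, residuePart_X_pow_mul hd (hc t), mul_assoc]

/-- The exponent `d - 1` on the variables in `s` and `0` elsewhere. -/
noncomputable def topResidue {n : ℕ} (d : ℕ) (s : Finset (Fin n)) : Fin n →₀ ℕ :=
  ∑ t ∈ s, Finsupp.single t (d - 1)

lemma topResidue_insert {n : ℕ} (d : ℕ) {s : Finset (Fin n)} {t : Fin n} (ht : t ∉ s) :
    topResidue d (insert t s) = topResidue d s + Finsupp.single t (d - 1) := by
  rw [topResidue, Finset.sum_insert ht, add_comm, topResidue]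

lemma topResidue_apply {n : ℕ} (d : ℕ) (s : Finset (Fin n)) (t : Fin n) :
    topResidue d s t = if t ∈ s then d - 1 else 0 := by
  unfold topResidue
  generalize d - 1 = e
  simp [Finsupp.finsetSum_apply, Finsupp.single_apply]

lemma degree_topResidue {n : ℕ} (d : ℕ) (s : Finset (Fin n)) :
    (topResidue d s).degree = s.card * (d - 1) := by
  unfold topResidue
  generalize d - 1 = e
  simp [map_sum]

lemma residuePart_monomial_self {n d : ℕ} (hd : 0 < d) (c : Fin n →₀ ℕ) :
    residuePart hd c (monomial c (1 : K)) = 1 := by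
  ext a
  rw [coeff_residuePart, coeff_monomial, coeff_one]
  have : c = d • a + c ↔ 0 = a := by
    rw [eq_comm, eq_comm (a := 0)]
    simp [hd.ne']
  simp only [this]

lemma residuePart_mem {n d : ℕ} (hd : 0 < d) {c : Fin n →₀ ℕ} (hc : ∀ t, c t < d)
    {I : Ideal (MvPolynomial (Fin n) K)} {g : MvPolynomial (Fin n) K}
    (hg : g ∈ I.map (powerMap K n d)) : residuePart hd c g ∈ I := by
  have key : ∀ a, residuePart hd c (a * g) ∈ I := by
    induction hg using Submodule.span_induction with
    | mem x hx =>
      obtain ⟨f, hf, rfl⟩ := hx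
      intro a
      rw [mul_comm]
      erw [residuePart_powerMap_mul hd hc f a]
      exact I.mul_mem_right _ hf
    | zero =>
      intro a
      rw [mul_zero, residuePart_zero]
      exact I.zero_mem
    | add x y _ _ hx hy =>
      intro a
      rw [mul_add, residuePart_add]
      exact I.add_mem (hx a) (hy a)
    | smul b x _ hx =>
      intro a
      rw [smul_eq_mul, ← mul_assoc]
      exact hx _
  simpa using key 1

lemma gradedBetti_map_powerMap_ne_zero {n d : ℕ} (hd : 0 < d)
    {I : Ideal (MvPolynomial (Fin n) K)} {i : ℕ} {j : ℤ} (h : gradedBetti I i j ≠ 0) :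
    gradedBetti (I.map (powerMap K n d)) i (d * j) ≠ 0 := by
  rw [gradedBetti_ne_zero_iff] at h ⊢
  obtain ⟨z, hz, hz0, hzb⟩ := h
  have hlt : ∀ s t, topResidue (n := n) d s t < d := by
    intro s t
    rw [topResidue_apply]
    split_ifs <;> omega
  have hd1 : ((d - 1 : ℕ) : ℤ) = d - 1 := by omega
  refine ⟨fun s => monomial (topResidue d s) 1 * powerMap K n d (z s), ⟨fun s hs => ?_,
    fun s hs => ?_⟩, ?_, fun w hw hwz => ?_⟩
  · have hzs := mem_idealPiece_iff.1 (hz.1 s hs)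
    refine mem_idealPiece_iff.2 ⟨Ideal.mul_mem_left _ _ (Ideal.mem_map_of_mem _ hzs.1), ?_⟩
    intro m hm
    rw [coeff_monomial_mul'] at hm
    split_ifs at hm with hle
    · rw [one_mul] at hm
      obtain ⟨a, ha, hne⟩ := coeff_powerMap_of_ne hm
      have hdeg := hzs.2 a hne
      have hm' : m = d • a + topResidue d s := by
        rw [← ha, tsub_add_cancel_of_le hle]
      rw [hm', map_add, map_nsmul, degree_topResidue, hs]
      push_cast
      rw [hd1, smul_eq_mul, Nat.cast_mul, hdeg]
      ring
    · exact absurd rfl hm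
  · simp [hz.2 s hs]
  · ext1 s
    have h0 := congrArg (powerMap K n d) (congrFun hz0 s)
    rw [fullKoszulDiff_apply, map_sum] at h0
    rw [fullKoszulDiff_apply, Pi.zero_apply]
    rw [Pi.zero_apply, map_zero] at h0
    rw [← mul_zero (monomial (topResidue d s) (1 : K)), ← h0, Finset.mul_sum]
    refine Finset.sum_congr rfl fun t ht => ?_
    have hX : (X t : MvPolynomial (Fin n) K) ^ d = X t ^ (d - 1) * X t := by
      rw [← pow_succ, Nat.sub_add_cancel hd]
    have hsign : powerMap K n d (koszulSign K t s) = koszulSign K t s := by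
      simp [koszulSign]
    rw [map_mul, map_mul, hsign, show powerMap K n d (X t) = X t ^ d from aeval_X _ _, hX,
      topResidue_insert d (Finset.mem_compl.1 ht), ← mul_one (1 : K), ← monomial_mul, mul_one,
      X_pow_eq_monomial]
    ring
  · refine hzb (fun s => residuePart hd (topResidue d s) (w s)) ⟨fun s hs => ?_, fun s hs => ?_⟩ ?_
    · have hws := mem_idealPiece_iff.1 (hw.1 s hs)
      refine mem_idealPiece_iff.2 ⟨residuePart_mem hd (hlt s) hws.1, fun a ha => ?_⟩
      rw [coeff_residuePart] at ha
      have hdeg := hws.2 _ ha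
      rw [map_add, map_nsmul, degree_topResidue, hs] at hdeg
      push_cast at hdeg ⊢
      rw [hd1, smul_eq_mul, Nat.cast_mul] at hdeg
      have : (d : ℤ) * a.degree = d * (j - (i + 1)) := by linarith
      exact mul_left_cancel₀ (by omega) this
    · simp only [hw.2 s hs, residuePart_zero]
    · ext1 s
      have h0 := congrArg (residuePart hd (topResidue d s)) (congrFun hwz s)
      rw [mul_comm, residuePart_powerMap_mul hd (hlt s), residuePart_monomial_self, mul_one,
        fullKoszulDiff_apply, residuePart_sum] at h0
      rw [← h0, fullKoszulDiff_apply]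
      refine Finset.sum_congr rfl fun t ht => ?_
      have hts := Finset.mem_compl.1 ht
      rw [residuePart_koszulSign_mul, residuePart_X_mul hd (by rw [topResidue_apply, if_neg hts]),
        topResidue_insert d hts]

lemma mem_idealPiece_natCast_iff {n : ℕ} {I : Ideal (MvPolynomial (Fin n) K)} {k : ℕ}
    {f : MvPolynomial (Fin n) K} : f ∈ idealPiece I (k : ℤ) ↔ f ∈ I ∧ f.IsHomogeneous k := by
  rw [idealPiece, if_pos (Int.natCast_nonneg k), Submodule.mem_inf,
    Submodule.restrictScalars_mem, mem_homogeneousSubmodule, Int.toNat_natCast]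

lemma idealPiece_of_neg {n : ℕ} {I : Ideal (MvPolynomial (Fin n) K)} {k : ℤ} (hk : k < 0)
    {f : MvPolynomial (Fin n) K} (hf : f ∈ idealPiece I k) : f = 0 := by
  rwa [idealPiece, if_neg (by omega), Submodule.mem_bot] at hf

lemma homogeneousComponent_monomial_mul {n : ℕ} (k : ℕ) (m : Fin n →₀ ℕ) (c : K)
    (y : MvPolynomial (Fin n) K) :
    homogeneousComponent k (monomial m c * y) =
      if m.degree ≤ k then monomial m c * homogeneousComponent (k - m.degree) y else 0 := by
  ext a
  split_ifs with h
  · rw [coeff_homogeneousComponent, coeff_monomial_mul', coeff_monomial_mul']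
    by_cases hma : m ≤ a
    · obtain ⟨b, rfl⟩ := exists_add_of_le hma
      have : (m + b).degree = k ↔ b.degree = k - m.degree := by
        rw [map_add]
        omega
      simp only [this, hma, if_true, coeff_homogeneousComponent, add_tsub_cancel_left]
      split_ifs <;> simp
    · simp [hma]
  · rw [coeff_homogeneousComponent, coeff_monomial_mul', coeff_zero]
    split_ifs with h1 h2
    · obtain ⟨b, rfl⟩ := exists_add_of_le h2
      rw [map_add] at h1
      omega
    · rfl
    · rfl

/-- A homogeneous element, of degree exceeding that of a family of homogeneous elements, of the
submodule spanned by that family lies in the product of the irrelevant ideal and the submodule. -/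
lemma exists_eq_sum_X_smul_of_mem_span {n : ℕ} {M : Type} [AddCommGroup M]
    [Module (MvPolynomial (Fin n) K) M] (comp : ℕ → M →+ M)
    (hcomp : ∀ k (m : Fin n →₀ ℕ) (c : K) y, comp k (monomial m c • y) =
      if m.degree ≤ k then monomial m c • comp (k - m.degree) y else 0)
    {G : Set M} {D : ℕ} (hG : ∀ g ∈ G, ∃ e ≤ D, ∀ k, comp k g = if k = e then g else 0)
    {z : M} (hz : z ∈ Submodule.span (MvPolynomial (Fin n) K) G) {k : ℕ} (hk : D < k) :
    ∃ w : Fin n → M, (∀ t, w t ∈ Submodule.span (MvPolynomial (Fin n) K) G ∧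
      comp (k - 1) (w t) = w t) ∧ comp k z = ∑ t, (X t : MvPolynomial (Fin n) K) • w t := by
  induction hz using Submodule.closure_induction with
  | zero => exact ⟨0, fun t => ⟨Submodule.zero_mem _, map_zero _⟩, by simp⟩
  | add x y _ _ hx hy =>
    obtain ⟨v, hv, hvx⟩ := hx
    obtain ⟨w, hw, hwy⟩ := hy
    refine ⟨v + w, fun t => ⟨Submodule.add_mem _ (hv t).1 (hw t).1, ?_⟩, ?_⟩
    · rw [Pi.add_apply, map_add, (hv t).2, (hw t).2]
    · simp [hvx, hwy, Finset.sum_add_distrib]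
  | smul_mem r g hg =>
    induction r using MvPolynomial.induction_on' with
    | add p q hp hq =>
      obtain ⟨v, hv, hvx⟩ := hp
      obtain ⟨w, hw, hwy⟩ := hq
      refine ⟨v + w, fun t => ⟨Submodule.add_mem _ (hv t).1 (hw t).1, ?_⟩, ?_⟩
      · rw [Pi.add_apply, map_add, (hv t).2, (hw t).2]
      · simp [add_smul, hvx, hwy, Finset.sum_add_distrib]
    | monomial m c =>
      obtain ⟨e, heD, he⟩ := hG g hg
      rw [hcomp, he]
      by_cases h : m.degree + e = k
      · rw [if_pos (by omega), if_pos (by omega)]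
        have hm : m ≠ 0 := by
          rintro rfl
          rw [map_zero] at h
          omega
        obtain ⟨t, ht⟩ := Finsupp.ne_iff.1 hm
        have hle : Finsupp.single t 1 ≤ m := by
          rw [Finsupp.single_le_iff]
          exact Nat.one_le_iff_ne_zero.2 ht
        obtain ⟨m', rfl⟩ := exists_add_of_le hle
        rw [map_add, Finsupp.degree_single] at h
        refine ⟨Pi.single t (monomial m' c • g), fun v => ?_, ?_⟩
        · by_cases hv : v = t
          · subst hv
            rw [Pi.single_eq_same, hcomp, he, if_pos (by omega), if_pos (by omega)]
            exact ⟨Submodule.smul_mem _ _ (Submodule.subset_span hg), rfl⟩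
          · rw [Pi.single_eq_of_ne hv, map_zero]
            exact ⟨Submodule.zero_mem _, rfl⟩
        · rw [Finset.sum_eq_single t, Pi.single_eq_same, smul_smul, X, monomial_mul, one_mul]
          · intro v _ hv
            rw [Pi.single_eq_of_ne hv, smul_zero]
          · simp
      · refine ⟨0, fun t => ⟨Submodule.zero_mem _, map_zero _⟩, ?_⟩
        split_ifs
        · omega
        · simp
        · simp

lemma exists_eq_sum_X_mul_of_mem_idealPiece_span {n : ℕ} {G : Set (MvPolynomial (Fin n) K)}
    {D : ℕ} (hG : ∀ g ∈ G, ∃ e ≤ D, g.IsHomogeneous e) {k : ℤ} (hk : (D : ℤ) < k)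
    {y : MvPolynomial (Fin n) K} (hy : y ∈ idealPiece (Ideal.span G) k) :
    ∃ w : Fin n → MvPolynomial (Fin n) K,
      (∀ t, w t ∈ idealPiece (Ideal.span G) (k - 1)) ∧ y = ∑ t, X t * w t := by
  lift k to ℕ using by omega
  rw [mem_idealPiece_natCast_iff] at hy
  obtain ⟨w, hw, hwy⟩ := exists_eq_sum_X_smul_of_mem_span
    (fun k => (homogeneousComponent k).toAddMonoidHom) (homogeneousComponent_monomial_mul)
    (G := G) (D := D) (fun g hg => by
      obtain ⟨e, he, hge⟩ := hG g hg
      exact ⟨e, he, fun k => homogeneousComponent_of_mem ((mem_homogeneousSubmodule _ _).2 hge)⟩)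
    hy.1 (by exact_mod_cast hk : D < k)
  refine ⟨w, fun t => ?_, ?_⟩
  · rw [show (k : ℤ) - 1 = ((k - 1 : ℕ) : ℤ) by omega, mem_idealPiece_natCast_iff]
    refine ⟨(hw t).1, ?_⟩
    rw [← (hw t).2]
    exact homogeneousComponent_isHomogeneous _ _
  · have := homogeneousComponent_eq_self hy.2
    exact this.symm.trans hwy

/-- The coefficientwise homogeneous component of a Koszul chain. -/
noncomputable def chainComponent (K : Type) [Field K] (n k : ℕ) :
    (Finset (Fin n) → MvPolynomial (Fin n) K) →+ (Finset (Fin n) → MvPolynomial (Fin n) K) where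
  toFun z s := homogeneousComponent k (z s)
  map_zero' := by
    ext1 s
    simp
  map_add' x y := by
    ext1 s
    simp

lemma chainComponent_apply {n : ℕ} (k : ℕ) (z : Finset (Fin n) → MvPolynomial (Fin n) K)
    (s : Finset (Fin n)) : chainComponent K n k z s = homogeneousComponent k (z s) := rfl

lemma chainComponent_monomial_smul {n : ℕ} (k : ℕ) (m : Fin n →₀ ℕ) (c : K)
    (y : Finset (Fin n) → MvPolynomial (Fin n) K) :
    chainComponent K n k (monomial m c • y) =
      if m.degree ≤ k then monomial m c • chainComponent K n (k - m.degree) y else 0 := by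
  ext1 s
  rw [chainComponent_apply, Pi.smul_apply, smul_eq_mul, homogeneousComponent_monomial_mul]
  split_ifs <;> rfl

lemma IsKoszulChain.chainComponent {n : ℕ} {I : Ideal (MvPolynomial (Fin n) K)} {i k' : ℕ}
    {y : Finset (Fin n) → MvPolynomial (Fin n) K} (hy : IsKoszulChain I i k' y) (k : ℕ) :
    chainComponent K n k y = if k = k' then y else 0 := by
  ext1 s
  rw [chainComponent_apply, homogeneousComponent_of_mem
    ((mem_homogeneousSubmodule _ _).2 (mem_idealPiece_natCast_iff.1 (hy.mem s)).2)]
  split_ifs <;> rfl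

lemma isKoszulChain_of_mem_span {n : ℕ} {I : Ideal (MvPolynomial (Fin n) K)} {i k : ℕ}
    {B : Set (Finset (Fin n) → MvPolynomial (Fin n) K)}
    (hB : ∀ b ∈ B, ∃ e : ℕ, IsKoszulChain I i e b)
    {w : Finset (Fin n) → MvPolynomial (Fin n) K}
    (hw : w ∈ Submodule.span (MvPolynomial (Fin n) K) B) (hwk : chainComponent K n k w = w) :
    IsKoszulChain I i k w := by
  have hcoeff : ∀ s, w s ∈ I ∧ (s.card ≠ i → w s = 0) := by
    clear hwk
    intro s
    induction hw using Submodule.span_induction with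
    | mem b hb =>
      obtain ⟨e, he⟩ := hB b hb
      exact ⟨(mem_idealPiece_iff.1 (he.mem s)).1, he.2 s⟩
    | zero => exact ⟨I.zero_mem, fun _ => rfl⟩
    | add x y _ _ hx hy =>
      refine ⟨I.add_mem hx.1 hy.1, fun h => ?_⟩
      rw [Pi.add_apply, hx.2 h, hy.2 h, add_zero]
    | smul a x _ hx =>
      refine ⟨I.mul_mem_left _ hx.1, fun h => ?_⟩
      rw [Pi.smul_apply, hx.2 h, smul_zero]
  refine ⟨fun s _ => mem_idealPiece_natCast_iff.2 ⟨(hcoeff s).1, ?_⟩, fun s => (hcoeff s).2⟩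
  rw [← congrFun hwk s]
  exact homogeneousComponent_isHomogeneous _ _

lemma exists_finset_koszulCycle_span {n : ℕ} (I : Ideal (MvPolynomial (Fin n) K)) (i : ℕ) :
    ∃ B : Finset (Finset (Fin n) → MvPolynomial (Fin n) K),
      (∀ b ∈ B, ∃ e : ℕ, IsKoszulChain I i e b ∧ fullKoszulDiff K n b = 0) ∧
      ∀ (e : ℕ) z, IsKoszulChain I i e z → fullKoszulDiff K n z = 0 →
        z ∈ Submodule.span (MvPolynomial (Fin n) K) (B : Set _) := by
  obtain ⟨B, hBA, hB⟩ := (Submodule.fg_span_iff_fg_span_finset_subset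
    (R := MvPolynomial (Fin n) K) {z | ∃ e : ℕ, IsKoszulChain I i e z ∧ fullKoszulDiff K n z = 0}).1
    (IsNoetherian.noetherian _)
  exact ⟨B, fun b hb => hBA hb, fun e z hz hz0 => hB.le (Submodule.subset_span ⟨e, hz, hz0⟩)⟩

lemma IsKoszulChain.exists_eq_sum_X_smul {n : ℕ} {I : Ideal (MvPolynomial (Fin n) K)} {i D : ℕ}
    {B : Set (Finset (Fin n) → MvPolynomial (Fin n) K)}
    (hB : ∀ b ∈ B, ∃ e : ℕ, e ≤ D ∧ IsKoszulChain I i e b)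
    {k : ℕ} {z : Finset (Fin n) → MvPolynomial (Fin n) K} (hz : IsKoszulChain I i k z)
    (hzB : z ∈ Submodule.span (MvPolynomial (Fin n) K) B) (hk : D < k) :
    ∃ w : Fin n → Finset (Fin n) → MvPolynomial (Fin n) K,
      (∀ t, w t ∈ Submodule.span (MvPolynomial (Fin n) K) B) ∧
      (∀ t, IsKoszulChain I i (k - 1 : ℕ) (w t)) ∧
      z = ∑ t, (X t : MvPolynomial (Fin n) K) • w t := by
  have hBc : ∀ b ∈ B, ∃ e ≤ D, ∀ k, _root_.chainComponent K n k b = if k = e then b else 0 :=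
    fun b hb => (hB b hb).imp fun e he => ⟨he.1, he.2.chainComponent⟩
  obtain ⟨w, hw, hwz⟩ := exists_eq_sum_X_smul_of_mem_span (_root_.chainComponent K n)
    chainComponent_monomial_smul hBc hzB hk
  refine ⟨w, fun t => (hw t).1, fun t => isKoszulChain_of_mem_span
    (fun b hb => (hB b hb).imp fun e he => he.2) (hw t).1 (hw t).2, ?_⟩
  rw [← hwz, hz.chainComponent, if_pos rfl]

lemma exists_sub_le_of_gradedBetti_ne_zero {n : ℕ} (I : Ideal (MvPolynomial (Fin n) K)) (i : ℕ) :
    ∃ D : ℕ, ∀ j : ℤ, gradedBetti I i j ≠ 0 → j - i ≤ D := by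
  obtain ⟨B, hBe, hB⟩ := exists_finset_koszulCycle_span I i
  obtain ⟨D, hD⟩ : ∃ D : ℕ, ∀ b ∈ B, ∃ e : ℕ, e ≤ D ∧
      IsKoszulChain I i e b ∧ fullKoszulDiff K n b = 0 := by
    choose! e he using hBe
    exact ⟨B.sup e, fun b hb => ⟨e b, Finset.le_sup hb, he b hb⟩⟩
  refine ⟨D, fun j hj => ?_⟩
  by_contra! hlt
  obtain ⟨z, hz, hz0, hzb⟩ := (gradedBetti_ne_zero_iff I i j).1 hj
  obtain ⟨k, hk⟩ : ∃ k : ℕ, j - i = k := ⟨(j - i).toNat, by omega⟩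
  have hk1 : j - (i + 1 : ℕ) = ((k - 1 : ℕ) : ℤ) := by omega
  rw [hk] at hz hlt
  rw [hk1] at hzb
  have hzB : z ∈ Submodule.span (MvPolynomial (Fin n) K) (B : Set _) :=
    hB k z hz hz0
  have hlt' : D < k := by exact_mod_cast hlt
  obtain ⟨w, hw, hchain, hwz⟩ := hz.exists_eq_sum_X_smul
    (fun b hb => (hD b hb).imp fun e he => ⟨he.1, he.2.1⟩) hzB hlt'
  have hker : ∀ t, fullKoszulDiff K n (w t) = 0 := by
    intro t
    have hle : Submodule.span (MvPolynomial (Fin n) K) (B : Set _) ≤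
        LinearMap.ker (fullKoszulDiff K n) :=
      Submodule.span_le.2 fun b hb => (hD b hb).choose_spec.2.2
    exact hle (hw t)
  refine hzb (∑ t, koszulWedge t (w t))
    (IsKoszulChain.sum _ fun t _ => (hchain t).koszulWedge t) ?_
  rw [map_sum, Finset.sum_congr rfl fun t _ => fullKoszulDiff_koszulWedge t (w t) (hker t), ← hwz]

lemma bddAbove_sub_gradedBetti_ne_zero {n : ℕ} (I : Ideal (MvPolynomial (Fin n) K)) :
    BddAbove {r : ℤ | ∃ (i : ℕ) (j : ℤ), gradedBetti I i j ≠ 0 ∧ r = j - i} := by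
  choose D hD using exists_sub_le_of_gradedBetti_ne_zero I
  refine ⟨((Finset.range (n + 1)).sup D : ℕ), ?_⟩
  rintro r ⟨i, j, hij, rfl⟩
  refine (hD i j hij).trans ?_
  have hi : i ≤ n := by
    obtain ⟨z, hz, hz0, hzb⟩ := (gradedBetti_ne_zero_iff I i j).1 hij
    by_contra! hn
    have hcard : ∀ s : Finset (Fin n), s.card ≤ n := fun s => by
      simpa using Finset.card_le_univ s
    have hz' : z = 0 := funext fun s => hz.2 s (by have := hcard s; omega)
    refine hzb 0 ⟨fun s _ => Submodule.zero_mem _, fun s _ => rfl⟩ ?_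
    rw [map_zero, hz']
  exact_mod_cast Finset.le_sup (f := D) (Finset.mem_range.2 (by omega))

/-- The Koszul chain of homological degree one with coefficients `y`. -/
noncomputable def singletonChain {n : ℕ} (y : Fin n → MvPolynomial (Fin n) K)
    (s : Finset (Fin n)) : MvPolynomial (Fin n) K :=
  if s.card = 1 then ∑ a ∈ s, y a else 0

lemma singletonChain_singleton {n : ℕ} (y : Fin n → MvPolynomial (Fin n) K) (a : Fin n) :
    singletonChain y {a} = y a := by
  simp [singletonChain]

lemma isKoszulChain_singletonChain {n : ℕ} {I : Ideal (MvPolynomial (Fin n) K)} {k : ℤ}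
    {y : Fin n → MvPolynomial (Fin n) K} (hy : ∀ a, y a ∈ idealPiece I k) :
    IsKoszulChain I 1 k (singletonChain y) := by
  refine ⟨fun s hs => ?_, fun s hs => if_neg hs⟩
  rw [singletonChain, if_pos hs]
  exact Submodule.sum_mem _ fun a _ => hy a

lemma fullKoszulDiff_singletonChain {n : ℕ} (y : Fin n → MvPolynomial (Fin n) K) :
    fullKoszulDiff K n (singletonChain y) = Pi.single ∅ (∑ t, X t * y t) := by
  ext1 s
  by_cases hs : s = ∅
  · subst hs
    rw [fullKoszulDiff_empty, Pi.single_eq_same]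
    simp only [singletonChain_singleton]
  · rw [Pi.single_eq_of_ne hs, fullKoszulDiff_apply]
    refine Finset.sum_eq_zero fun t ht => ?_
    have := Finset.card_pos.2 (Finset.nonempty_iff_ne_empty.2 hs)
    rw [singletonChain, if_neg, mul_zero, mul_zero]
    rw [Finset.card_insert_of_notMem (Finset.mem_compl.1 ht)]
    omega

lemma le_of_gradedBetti_zero_ne_zero {n : ℕ} {G : Set (MvPolynomial (Fin n) K)} {D : ℕ}
    (hG : ∀ g ∈ G, ∃ e ≤ D, g.IsHomogeneous e) {j : ℤ}
    (h : gradedBetti (Ideal.span G) 0 j ≠ 0) : j ≤ D := by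
  by_contra! hlt
  obtain ⟨z, hz, -, hzb⟩ := (gradedBetti_ne_zero_iff _ _ _).1 h
  rw [Nat.cast_zero, sub_zero] at hz
  obtain ⟨w, hw, hwz⟩ := exists_eq_sum_X_mul_of_mem_idealPiece_span hG hlt (hz.mem ∅)
  refine hzb (singletonChain w) ?_ ?_
  · simpa using isKoszulChain_singletonChain hw
  · rw [fullKoszulDiff_singletonChain, ← hwz]
    ext1 s
    by_cases hs : s = ∅
    · subst hs
      rw [Pi.single_eq_same]
    · rw [Pi.single_eq_of_ne hs, hz.2 s (by simpa using hs)]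

/-- If all first syzygies of `I` have degree at most `t`, a generator `g` of degree `t`
generates a free direct summand of `I`. -/
lemma eq_zero_of_mul_mem {n t : ℕ} {I J : Ideal (MvPolynomial (Fin n) K)}
    {g : MvPolynomial (Fin n) K} (hgI : g ∈ I) (hgt : g.IsHomogeneous t) (hJI : J ≤ I)
    (hgJ : g ∉ J)
    (hdec : ∀ e, ∀ y ∈ idealPiece I e, ∃ p ∈ idealPiece (⊤ : Ideal (MvPolynomial (Fin n) K)) (e - t),
      ∃ q ∈ J, y = p * g + q)
    (hJ : ∀ k : ℤ, t < k → ∀ y ∈ idealPiece J k, ∃ w : Fin n → MvPolynomial (Fin n) K,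
      (∀ s, w s ∈ idealPiece J (k - 1)) ∧ y = ∑ s, X s * w s)
    (hβ : ∀ j : ℤ, t < j → gradedBetti I 1 j = 0) (k : ℕ) {h : MvPolynomial (Fin n) K}
    (hh : h.IsHomogeneous k) (hmem : h * g ∈ J) : h = 0 := by
  induction k generalizing h with
  | zero =>
    obtain ⟨r, rfl⟩ : ∃ r, h = C r := ⟨_, totalDegree_eq_zero_iff_eq_C.1
      (Nat.le_zero.1 hh.totalDegree_le)⟩
    by_contra hr
    have hr' : r ≠ 0 := fun h0 => hr (by rw [h0, C_0])
    apply hgJ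
    have := J.mul_mem_left (C r⁻¹) hmem
    rwa [← mul_assoc, ← C_mul, inv_mul_cancel₀ hr', C_1, one_mul] at this
  | succ k ih =>
    have htop : Ideal.span {(1 : MvPolynomial (Fin n) K)} = ⊤ := Ideal.span_singleton_one
    obtain ⟨a, ha, hha⟩ := exists_eq_sum_X_mul_of_mem_idealPiece_span (n := n) (K := K)
      (G := {1}) (D := 0) (k := (k + 1 : ℕ)) (y := h)
      (fun g hg => ⟨0, le_rfl, (Set.mem_singleton_iff.1 hg) ▸ isHomogeneous_one _ _⟩)
      (by push_cast; omega)
      (mem_idealPiece_natCast_iff.2 ⟨by rw [htop]; trivial, hh⟩)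
    rw [htop, show ((k + 1 : ℕ) : ℤ) - 1 = (k : ℕ) by push_cast; ring] at ha
    obtain ⟨v, hv, hhv⟩ := hJ (k + 1 + t : ℕ) (by push_cast; omega) (h * g)
      (mem_idealPiece_natCast_iff.2 ⟨hmem, hh.mul hgt⟩)
    rw [show ((k + 1 + t : ℕ) : ℤ) - 1 = (k + t : ℕ) by push_cast; ring] at hv
    have hy : ∀ s, a s * g - v s ∈ idealPiece I (k + t : ℕ) := fun s =>
      mem_idealPiece_natCast_iff.2
        ⟨I.sub_mem (I.mul_mem_left _ hgI) (hJI (mem_idealPiece_natCast_iff.1 (hv s)).1),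
        ((mem_idealPiece_natCast_iff.1 (ha s)).2.mul hgt).sub
          (mem_idealPiece_natCast_iff.1 (hv s)).2⟩
    have hcycle : fullKoszulDiff K n (singletonChain fun s => a s * g - v s) = 0 := by
      have : ∑ s, X s * (a s * g - v s) = 0 := by
        simp only [mul_sub, Finset.sum_sub_distrib, ← mul_assoc, ← Finset.sum_mul]
        rw [← hha, ← hhv, sub_self]
      rw [fullKoszulDiff_singletonChain, this, Pi.single_zero]
    have hβ' := hβ (k + 1 + t : ℕ) (by push_cast; omega)
    obtain ⟨w, hw, hwy⟩ : ∃ w, IsKoszulChain I 2 (((k + t : ℕ) : ℤ) - 1) w ∧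
        fullKoszulDiff K n w = singletonChain fun s => a s * g - v s := by
      by_contra! hcon
      refine (gradedBetti_ne_zero_iff I 1 (k + 1 + t : ℕ)).2 ⟨_, ?_, hcycle, ?_⟩ hβ'
      · convert isKoszulChain_singletonChain hy using 1
        push_cast
        ring
      · intro w hw
        refine hcon w ?_
        convert hw using 1
        push_cast
        omega
    choose p hp q hq hpq using fun s => hdec _ (w s) (hw.mem s)
    have hw' : w = g • p + q := by
      ext1 s
      rw [hpq s, Pi.add_apply, Pi.smul_apply, smul_eq_mul, mul_comm]
    have hap : ∀ s, a s = fullKoszulDiff K n p {s} := by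
      intro s
      refine sub_eq_zero.1 (ih ?_ ?_)
      · refine (mem_idealPiece_natCast_iff.1 (ha s)).2.sub
          (mem_idealPiece_natCast_iff.1 (fullKoszulDiff_mem_idealPiece (I := ⊤) (fun s => ?_) {s})).2
        convert hp s using 2
        push_cast
        ring
      · have hs := congrFun hwy {s}
        rw [singletonChain_singleton, hw', map_add, map_smul, Pi.add_apply, Pi.smul_apply,
          smul_eq_mul] at hs
        have : (a s - fullKoszulDiff K n p {s}) * g = v s + fullKoszulDiff K n q {s} := by
          linear_combination -hs
        rw [this]
        exact J.add_mem (mem_idealPiece_natCast_iff.1 (hv s)).1 (fullKoszulDiff_mem hq _)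
    rw [hha]
    simp only [hap]
    exact sum_X_mul_fullKoszulDiff_singleton p

lemma homogeneousComponent_mul_of_isHomogeneous {n t : ℕ} {g : MvPolynomial (Fin n) K}
    (hg : g.IsHomogeneous t) (k : ℕ) (a : MvPolynomial (Fin n) K) :
    homogeneousComponent k (a * g) = if t ≤ k then homogeneousComponent (k - t) a * g else 0 := by
  induction a using MvPolynomial.induction_on' with
  | monomial m c =>
    rw [homogeneousComponent_monomial_mul,
      homogeneousComponent_of_mem ((mem_homogeneousSubmodule _ _).2 hg),
      homogeneousComponent_of_mem ((mem_homogeneousSubmodule _ _).2 (isHomogeneous_monomial c rfl))]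
    split_ifs <;> first | rfl | omega | simp
  | add p q hp hq =>
    rw [add_mul, map_add, hp, hq]
    split_ifs
    · rw [map_add, add_mul]
    · rw [add_zero]

lemma homogeneousComponent_mem_span {n : ℕ} {G : Set (MvPolynomial (Fin n) K)}
    (hG : ∀ g ∈ G, ∃ e, g.IsHomogeneous e) {f : MvPolynomial (Fin n) K}
    (hf : f ∈ Ideal.span G) (k : ℕ) : homogeneousComponent k f ∈ Ideal.span G := by
  let _ : GradedAlgebra (homogeneousSubmodule (Fin n) K) := MvPolynomial.gradedAlgebra
  refine homogeneousComponent_mem_of_mem (Ideal.homogeneous_span _ _ fun g hg => ?_) hf k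
  obtain ⟨e, he⟩ := hG g hg
  exact ⟨e, (mem_homogeneousSubmodule _ _).2 he⟩

lemma exists_finset_homogeneous_span_eq {n : ℕ} {I : Ideal (MvPolynomial (Fin n) K)}
    (hI : IsHomogeneousIdeal I) : ∃ G : Finset (MvPolynomial (Fin n) K),
      (∀ g ∈ G, ∃ e, g.IsHomogeneous e) ∧ Ideal.span (G : Set (MvPolynomial (Fin n) K)) = I := by
  have hspan : Ideal.span {f | f ∈ I ∧ ∃ e, f.IsHomogeneous e} = I := by
    refine le_antisymm (Ideal.span_le.2 fun f hf => hf.1) fun f hf => ?_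
    rw [← sum_homogeneousComponent f]
    exact Submodule.sum_mem _ fun k _ =>
      Ideal.subset_span ⟨hI f hf k, k, homogeneousComponent_isHomogeneous _ _⟩
  obtain ⟨G, hG, hGI⟩ := (Submodule.fg_span_iff_fg_span_finset_subset
    {f | f ∈ I ∧ ∃ e, f.IsHomogeneous e}).1 (IsNoetherian.noetherian
      (Ideal.span {f | f ∈ I ∧ ∃ e, f.IsHomogeneous e}))
  exact ⟨G, fun g hg => (hG hg).2, hGI.symm.trans hspan⟩

/-- A homogeneous ideal that is not principal has a first syzygy of degree exceeding the degrees
of all of its minimal generators. -/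
lemma exists_gradedBetti_one_ne_zero {n : ℕ} {I : Ideal (MvPolynomial (Fin n) K)}
    (hI : IsHomogeneousIdeal I) (hprin : ¬ I.IsPrincipal) :
    ∃ t : ℕ, (∀ j, gradedBetti I 0 j ≠ 0 → j ≤ t) ∧
      ∃ j : ℤ, t < j ∧ gradedBetti I 1 j ≠ 0 := by
  classical
  obtain ⟨G, ⟨hGh, hGI⟩, hmin⟩ := exists_minimal_of_wellFoundedLT
    (fun G : Finset (MvPolynomial (Fin n) K) => (∀ g ∈ G, ∃ e, g.IsHomogeneous e) ∧
      Ideal.span (G : Set (MvPolynomial (Fin n) K)) = I) (exists_finset_homogeneous_span_eq hI)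
  have herase : ∀ g ∈ G, g ∉ Ideal.span ((G.erase g : Finset _) : Set (MvPolynomial (Fin n) K)) := by
    intro g hg hmem
    refine Finset.notMem_erase g G (hmin (y := G.erase g)
      ⟨fun f hf => hGh f (Finset.mem_of_mem_erase hf), ?_⟩ (Finset.erase_subset _ _) hg)
    rw [← hGI]
    refine le_antisymm (Ideal.span_mono (Finset.coe_subset.2 (Finset.erase_subset _ _)))
      (Ideal.span_le.2 fun f hf => ?_)
    by_cases h : f = g
    · exact h ▸ hmem
    · exact Ideal.subset_span (Finset.mem_coe.2 (Finset.mem_erase.2 ⟨h, hf⟩))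
  choose! deg hdeg using hGh
  have hne : G.Nonempty := by
    rw [Finset.nonempty_iff_ne_empty]
    rintro rfl
    refine hprin ⟨0, ?_⟩
    rw [← hGI]
    simp
  obtain ⟨g, hg, hgmax⟩ := G.exists_max_image deg hne
  have hG' : ∀ f ∈ (G : Set (MvPolynomial (Fin n) K)), ∃ e ≤ deg g, f.IsHomogeneous e :=
    fun f hf => ⟨deg f, hgmax f hf, hdeg f hf⟩
  have hGe : ∀ f ∈ ((G.erase g : Finset _) : Set (MvPolynomial (Fin n) K)),
      ∃ e ≤ deg g, f.IsHomogeneous e := fun f hf => hG' f (Finset.mem_of_mem_erase hf)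
  refine ⟨deg g, fun j hj => le_of_gradedBetti_zero_ne_zero hG' (hGI ▸ hj), ?_⟩
  by_contra! hcon
  obtain ⟨f, hf⟩ : (G.erase g).Nonempty := by
    rw [Finset.nonempty_iff_ne_empty]
    intro h0
    refine hprin ⟨g, ?_⟩
    rw [← hGI, ← Finset.insert_erase hg, h0]
    simp [Ideal.submodule_span_eq]
  have hfG := Finset.mem_of_mem_erase hf
  have hf0 : f = 0 := by
    refine eq_zero_of_mul_mem (I := I)
      (J := Ideal.span ((G.erase g : Finset _) : Set (MvPolynomial (Fin n) K)))
      (hGI ▸ Ideal.subset_span hg) (hdeg g hg) ?_ (herase g hg) ?_ ?_ hcon (deg f) (hdeg f hfG)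
      (Ideal.mul_mem_right _ _ (Ideal.subset_span hf))
    · rw [← hGI]
      exact Ideal.span_mono (Finset.coe_subset.2 (Finset.erase_subset _ _))
    · intro e y hy
      rcases lt_or_ge e 0 with he | he
      · exact ⟨0, Submodule.zero_mem _, 0, Ideal.zero_mem _, by
          rw [idealPiece_of_neg he hy, zero_mul, zero_add]⟩
      lift e to ℕ using he
      rw [mem_idealPiece_natCast_iff, ← hGI, ← Finset.insert_erase hg, Finset.coe_insert,
        Ideal.mem_span_insert] at hy
      obtain ⟨⟨a, b, hb, rfl⟩, hye⟩ := hy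
      have hbe := homogeneousComponent_mem_span
        (fun f hf => (hGe f hf).imp fun e he => he.2) hb e
      have hself := homogeneousComponent_eq_self hye
      rw [map_add, homogeneousComponent_mul_of_isHomogeneous (hdeg g hg)] at hself
      split_ifs at hself with hle
      · refine ⟨_, ?_, _, hbe, hself.symm⟩
        rw [show (e : ℤ) - deg g = (e - deg g : ℕ) by omega, mem_idealPiece_natCast_iff]
        exact ⟨trivial, homogeneousComponent_isHomogeneous _ _⟩
      · exact ⟨0, Submodule.zero_mem _, _, hbe, by rw [zero_mul, hself]⟩
    · intro k hk y hy
      exact exists_eq_sum_X_mul_of_mem_idealPiece_span hGe hk hy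
  apply herase f hfG
  rw [hf0]
  exact Ideal.zero_mem _

/-- Let `α : R → R` be the `K`-algebra map of `R = K[x_1,…,x_n]` with `α(x_i) = x_i^d`,
`d > 0`, and `I' = α(I)R` for a homogeneous ideal `I`.  If the inequality
`reg(I) ≤ reg(I')/d` is an equality, then `d = 1` or `I` is principal. -/
theorem eq_reg_power_map_imp {n : ℕ} (d : ℕ) (hd : 0 < d)
    (I : Ideal (MvPolynomial (Fin n) K)) (hI : IsHomogeneousIdeal I)
    (heq : (reg I : ℚ) =
      (reg (Ideal.map
        (aeval (fun i => (X i : MvPolynomial (Fin n) K) ^ d) :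
          MvPolynomial (Fin n) K →ₐ[K] MvPolynomial (Fin n) K) I) : ℚ) / d) :
    d = 1 ∨ I.IsPrincipal := by
  refine or_iff_not_imp_right.2 fun hprin => ?_
  by_contra hd1
  have hreg : reg (I.map (powerMap K n d)) = d * reg I := by
    have hd0 : (d : ℚ) ≠ 0 := by exact_mod_cast hd.ne'
    rw [eq_div_iff hd0, mul_comm] at heq
    exact_mod_cast heq.symm
  obtain ⟨t, ht, j₁, hj₁, hβ₁⟩ := exists_gradedBetti_one_ne_zero hI hprin
  have hd2 : (2 : ℤ) ≤ d := by omega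
  have hle : ∀ (i : ℕ) (j : ℤ), gradedBetti I i j ≠ 0 → d * j - i ≤ d * reg I := by
    intro i j hij
    rw [← hreg]
    exact le_csSup (bddAbove_sub_gradedBetti_ne_zero _)
      ⟨i, d * j, gradedBetti_map_powerMap_ne_zero hd hij, rfl⟩
  obtain ⟨i, j, hij, hr⟩ : ∃ (i : ℕ) (j : ℤ), gradedBetti I i j ≠ 0 ∧ reg I = j - i :=
    Int.csSup_mem (s := {r : ℤ | ∃ (i : ℕ) (j : ℤ), gradedBetti I i j ≠ 0 ∧ r = j - i})
      ⟨_, 1, j₁, hβ₁, rfl⟩ (bddAbove_sub_gradedBetti_ne_zero I)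
  rcases Nat.eq_zero_or_pos i with rfl | hi
  · have h₁ := hle 1 j₁ hβ₁
    have h₀ := ht j hij
    rw [hr] at h₁
    push_cast at h₁
    nlinarith
  · have h₁ := hle i j hij
    rw [hr] at h₁
    have : (1 : ℤ) ≤ i := by exact_mod_cast hi
    nlinarith
end

section
/- Let S = K[x_1,...,x_ℓ] over a field K with subring R = K[x_1,...,x_n] for n ≤ ℓ, let d_1,...,d_ℓ be positive integers, φ: S → S the K-algebra map with φ(x_i) = x_i^{d_i}, and α: R → R its restriction. For an ideal J of S set I = J ∩ R, J' = φ(J)S and I' = α(I)R. Then I' = J' ∩ R. -/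
open MvPolynomial

namespace MvPolynomial

variable {σ τ K : Type*} [Field K]

/-- The `K`-algebra endomorphism `x_i ↦ x_i ^ d_i`. -/
noncomputable def powMap (d : σ → ℕ) : MvPolynomial σ K →ₐ[K] MvPolynomial σ K :=
  aeval fun i => X i ^ d i

lemma powMap_rename (j : τ → σ) (d : σ → ℕ) (f : MvPolynomial τ K) :
    powMap d (rename j f) = rename j (powMap (d ∘ j) f) := by
  have key : (powMap d).comp (rename j) = (rename j).comp (powMap (K := K) (d ∘ j)) := by
    ext i; simp [powMap]
  exact DFunLike.congr_fun key f

section Residue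

variable [Finite σ] [Finite τ]

/-- The coordinatewise remainder of an exponent vector. -/
noncomputable def expMod (d : σ → ℕ) (b : σ →₀ ℕ) : σ →₀ ℕ :=
  Finsupp.equivFunOnFinite.symm fun i => b i % d i

/-- The coordinatewise quotient of an exponent vector. -/
noncomputable def expDiv (d : σ → ℕ) (b : σ →₀ ℕ) : σ →₀ ℕ :=
  Finsupp.equivFunOnFinite.symm fun i => b i / d i

/-- The coordinatewise product of an exponent vector with `d`. -/
noncomputable def expMul (d : σ → ℕ) (b : σ →₀ ℕ) : σ →₀ ℕ :=
  Finsupp.equivFunOnFinite.symm fun i => d i * b i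

open Classical in
/-- The `K`-linear map sending `x ^ (d m + e)` to `x ^ m` and killing the monomials whose exponent
is not congruent to `e` modulo `d`. -/
noncomputable def residuePart (d : σ → ℕ) (e : σ →₀ ℕ) :
    MvPolynomial σ K →ₗ[K] MvPolynomial σ K :=
  (basisMonomials σ K).constr K fun b => if expMod d b = e then monomial (expDiv d b) 1 else 0

open Classical in
lemma residuePart_monomial (d : σ → ℕ) (e b : σ →₀ ℕ) :
    residuePart d e (monomial b (1 : K)) =
      if expMod d b = e then monomial (expDiv d b) 1 else 0 := by
  have := (basisMonomials σ K).constr_basis K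
    (fun b => if expMod d b = e then monomial (expDiv d b) (1 : K) else 0) b
  rwa [coe_basisMonomials] at this

lemma powMap_monomial (d : σ → ℕ) (b : σ →₀ ℕ) :
    powMap d (monomial b (1 : K)) = monomial (expMul d b) 1 := by
  have := Fintype.ofFinite σ
  rw [powMap, aeval_monomial, map_one, one_mul, monomial_eq, C_1, one_mul,
    Finsupp.prod_fintype _ _ (by simp), Finsupp.prod_fintype _ _ (by simp)]
  simp [expMul, pow_mul]

lemma residuePart_powMap_mul (d : σ → ℕ) (hd : ∀ i, 0 < d i) (e : σ →₀ ℕ)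
    (g s : MvPolynomial σ K) :
    residuePart d e (powMap d g * s) = g * residuePart d e s := by
  classical
  have key : ((LinearMap.mul K (MvPolynomial σ K)).compl₁₂
      (powMap d).toLinearMap LinearMap.id).compr₂ (residuePart d e) =
      (LinearMap.mul K (MvPolynomial σ K)).compl₁₂ LinearMap.id (residuePart d e) := by
    refine (basisMonomials σ K).ext fun a => (basisMonomials σ K).ext fun b => ?_
    have h₁ : expMod d (expMul d a + b) = expMod d b := by
      ext i; simp [expMod, expMul]
    have h₂ : expDiv d (expMul d a + b) = a + expDiv d b := by
      ext i; simp [expDiv, expMul, Nat.mul_add_div (hd i)]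
    simp only [coe_basisMonomials, LinearMap.compr₂_apply, LinearMap.compl₁₂_apply,
      AlgHom.toLinearMap_apply, LinearMap.id_apply, LinearMap.mul_apply', powMap_monomial,
      monomial_mul, one_mul, residuePart_monomial, h₁, h₂]
    split_ifs <;> simp [monomial_mul]
  exact LinearMap.congr_fun₂ key g s

open Classical in
lemma sum_monomial_mul_powMap_residuePart (d : σ → ℕ) (hd : ∀ i, 0 < d i)
    (f : MvPolynomial σ K) :
    ∑ e ∈ Finset.Icc 0 (Finsupp.equivFunOnFinite.symm d),
      monomial e 1 * powMap d (residuePart d e f) = f := by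
  have key : ∑ e ∈ Finset.Icc 0 (Finsupp.equivFunOnFinite.symm d),
      LinearMap.mulLeft K (monomial e (1 : K)) ∘ₗ (powMap d).toLinearMap ∘ₗ residuePart d e =
      LinearMap.id := by
    refine (basisMonomials σ K).ext fun b => ?_
    have hb : expMod d b + expMul d (expDiv d b) = b := by
      ext i; simp [expMod, expMul, expDiv, Nat.mod_add_div]
    simp only [coe_basisMonomials, LinearMap.sum_apply, LinearMap.comp_apply,
      LinearMap.mulLeft_apply, AlgHom.toLinearMap_apply, LinearMap.id_apply]
    rw [Finset.sum_eq_single (expMod d b)]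
    · rw [residuePart_monomial, if_pos rfl, powMap_monomial, monomial_mul, hb, one_mul]
    · intro e _ he
      rw [residuePart_monomial, if_neg he.symm, map_zero, mul_zero]
    · refine fun hmem => absurd (Finset.mem_Icc.2 ⟨zero_le, fun i => ?_⟩) hmem
      simpa [expMod] using (Nat.mod_lt (b i) (hd i)).le
  simpa [LinearMap.sum_apply] using LinearMap.congr_fun key f

lemma expMod_mapDomain {j : τ → σ} (hj : Function.Injective j) (d : σ → ℕ) (b : τ →₀ ℕ) :
    expMod d (b.mapDomain j) = (expMod (d ∘ j) b).mapDomain j := by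
  ext i
  by_cases hi : i ∈ Set.range j
  · obtain ⟨k, rfl⟩ := hi
    simp [expMod, Finsupp.mapDomain_apply hj]
  · simp [expMod, Finsupp.mapDomain_of_notMem_range _ _ hi]

lemma expDiv_mapDomain {j : τ → σ} (hj : Function.Injective j) (d : σ → ℕ) (b : τ →₀ ℕ) :
    expDiv d (b.mapDomain j) = (expDiv (d ∘ j) b).mapDomain j := by
  ext i
  by_cases hi : i ∈ Set.range j
  · obtain ⟨k, rfl⟩ := hi
    simp [expDiv, Finsupp.mapDomain_apply hj]
  · simp [expDiv, Finsupp.mapDomain_of_notMem_range _ _ hi]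

lemma residuePart_rename {j : τ → σ} (hj : Function.Injective j) (d : σ → ℕ) (e : τ →₀ ℕ)
    (f : MvPolynomial τ K) :
    residuePart d (e.mapDomain j) (rename j f) = rename j (residuePart (d ∘ j) e f) := by
  have key : residuePart d (e.mapDomain j) ∘ₗ (rename j).toLinearMap =
      (rename j).toLinearMap ∘ₗ residuePart (K := K) (d ∘ j) e := by
    refine (basisMonomials τ K).ext fun b => ?_
    have hb : expMod d (b.mapDomain j) = e.mapDomain j ↔ expMod (d ∘ j) b = e := by
      rw [expMod_mapDomain hj, (Finsupp.mapDomain_injective hj).eq_iff]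
    simp only [coe_basisMonomials, LinearMap.comp_apply, AlgHom.toLinearMap_apply,
      rename_monomial, residuePart_monomial, expDiv_mapDomain hj]
    split_ifs with h₁ h₂ h₂
    · rw [rename_monomial]
    · exact absurd (hb.1 h₁) h₂
    · exact absurd (hb.2 h₂) h₁
    · rw [map_zero]
  exact LinearMap.congr_fun key f

lemma residuePart_mem_of_mem_map (d : σ → ℕ) (hd : ∀ i, 0 < d i) (e : σ →₀ ℕ)
    {J : Ideal (MvPolynomial σ K)} {f : MvPolynomial σ K} (hf : f ∈ J.map (powMap d)) :
    residuePart d e f ∈ J := by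
  refine Submodule.span_induction (p := fun f _ => ∀ s, residuePart d e (f * s) ∈ J)
    ?_ ?_ ?_ ?_ hf 1 |> fun h => by simpa using h
  · rintro _ ⟨g, hg, rfl⟩ s
    simpa only [RingHom.coe_coe, residuePart_powMap_mul d hd] using J.mul_mem_right _ hg
  · simp
  · intro x y _ _ hx hy s
    simpa only [add_mul, map_add] using J.add_mem (hx s) (hy s)
  · intro a x _ hx s
    have := hx (a * s)
    rwa [smul_eq_mul, mul_comm a x, mul_assoc]

lemma mem_map_of_residuePart_mem (d : σ → ℕ) (hd : ∀ i, 0 < d i)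
    {I : Ideal (MvPolynomial σ K)} {f : MvPolynomial σ K} (hf : ∀ e, residuePart d e f ∈ I) :
    f ∈ I.map (powMap d) := by
  classical
  rw [← sum_monomial_mul_powMap_residuePart d hd f]
  exact Ideal.sum_mem _ fun e _ => Ideal.mul_mem_left _ _ (Ideal.mem_map_of_mem _ (hf e))

/-- Contraction along an inclusion of variables commutes with extension along the power map. -/
lemma map_powMap_comap_rename {j : τ → σ} (hj : Function.Injective j) (d : σ → ℕ)
    (hd : ∀ i, 0 < d i) (J : Ideal (MvPolynomial σ K)) :
    (J.comap (rename j : MvPolynomial τ K →ₐ[K] MvPolynomial σ K)).map (powMap (d ∘ j)) =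
      (J.map (powMap d)).comap (rename j : MvPolynomial τ K →ₐ[K] MvPolynomial σ K) := by
  apply le_antisymm
  · rw [Ideal.map_le_iff_le_comap]
    intro f hf
    rw [Ideal.mem_comap, Ideal.mem_comap, ← powMap_rename]
    exact Ideal.mem_map_of_mem _ hf
  · intro f hf
    refine mem_map_of_residuePart_mem (d ∘ j) (fun i => hd (j i)) fun e => ?_
    rw [Ideal.mem_comap, ← residuePart_rename hj]
    exact residuePart_mem_of_mem_map d hd _ hf

end Residue

end MvPolynomial

/-- Let `S = K[x_1,…,x_ℓ] ⊇ R = K[x_1,…,x_n]`, let `φ : S → S` be the `K`-algebra map with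
`φ(x_i) = x_i^{d_i}` (`d_i > 0`) and `α : R → R` its restriction.  For an ideal `J` of `S`
let `I = J ∩ R` (the contraction of `J` along the inclusion `R ⊆ S`), `J' = φ(J)S` and
`I' = α(I)R` (the extensions of the images).  Then `I' = J' ∩ R`. -/
theorem contraction_of_power_map {K : Type} [Field K] {n ℓ : ℕ} (h : n ≤ ℓ)
    (dv : Fin ℓ → ℕ) (hdv : ∀ i, 0 < dv i) (J : Ideal (MvPolynomial (Fin ℓ) K)) :
    Ideal.map
        (aeval (fun i : Fin n => (X i : MvPolynomial (Fin n) K) ^ dv (Fin.castLE h i)) :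
          MvPolynomial (Fin n) K →ₐ[K] MvPolynomial (Fin n) K)
        (Ideal.comap
          (rename (Fin.castLE h) : MvPolynomial (Fin n) K →ₐ[K] MvPolynomial (Fin ℓ) K) J) =
      Ideal.comap
        (rename (Fin.castLE h) : MvPolynomial (Fin n) K →ₐ[K] MvPolynomial (Fin ℓ) K)
        (Ideal.map
          (aeval (fun i : Fin ℓ => (X i : MvPolynomial (Fin ℓ) K) ^ dv i) :
            MvPolynomial (Fin ℓ) K →ₐ[K] MvPolynomial (Fin ℓ) K) J) := by
  exact map_powMap_comap_rename (Fin.castLE_injective h) dv hdv J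
end

section
/- Let S = K[x_1,...,x_ℓ] over a field K, let d_1,...,d_ℓ be positive integers, φ: S → S the K-algebra map with φ(x_i) = x_i^{d_i}, and let < be the lexicographic order with x_ℓ > ... > x_1. Then for all nonzero f, h ∈ S, the S-polynomials satisfy φ(S(f,h)) = S(φ(f), φ(h)). -/
open MvPolynomial

/-- The lexicographic order on exponent vectors of monomials in `x_1,…,x_ℓ` with
`x_ℓ > x_{ℓ-1} > … > x_1` : `v < w` iff `w` beats `v` at the largest index where they differ. -/
def LexLT {ℓ : ℕ} (v w : Fin ℓ →₀ ℕ) : Prop :=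
  ∃ i : Fin ℓ, v i < w i ∧ ∀ j : Fin ℓ, i < j → v j = w j

/-- `v` is the exponent vector of the leading (initial) monomial of `f` with respect to the
lexicographic order with `x_ℓ > … > x_1`. -/
def IsLeadingMonomial {ℓ : ℕ} {K : Type} [Field K]
    (f : MvPolynomial (Fin ℓ) K) (v : Fin ℓ →₀ ℕ) : Prop :=
  v ∈ f.support ∧ ∀ w ∈ f.support, w ≠ v → LexLT w v

/-- Pointwise scaling `v ↦ (d_i v_i)_i` of an exponent vector; this is the effect of the
substitution `x_i ↦ x_i^{d_i}` on monomials. -/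
noncomputable def expScale {ℓ : ℕ} (dv : Fin ℓ → ℕ) (v : Fin ℓ →₀ ℕ) : Fin ℓ →₀ ℕ :=
  Finsupp.equivFunOnFinite.symm (fun i => dv i * v i)

/-- The S-polynomial of `f` and `h` whose leading monomials have exponent vectors `v` and `w`:
`S(f,h) = (m / lt(f))·f − (m / lt(h))·h`, where `lt` is the leading term and
`m = lcm(x^v, x^w) = x^(v ⊔ w)`. -/
noncomputable def sPoly {ℓ : ℕ} {K : Type} [Field K]
    (f h : MvPolynomial (Fin ℓ) K) (v w : Fin ℓ →₀ ℕ) : MvPolynomial (Fin ℓ) K :=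
  (monomial (v ⊔ w - v) ((f.coeff v)⁻¹)) * f - (monomial (v ⊔ w - w) ((h.coeff w)⁻¹)) * h

theorem LexLT.asymm {ℓ : ℕ} {v w : Fin ℓ →₀ ℕ} (hvw : LexLT v w) : ¬ LexLT w v := by
  rintro ⟨j, hj, hj'⟩
  obtain ⟨i, hi, hi'⟩ := hvw
  rcases lt_trichotomy i j with hij | rfl | hij
  · exact hj.ne' (hi' j hij)
  · exact lt_asymm hi hj
  · exact hi.ne' (hj' i hij)

theorem IsLeadingMonomial.unique {ℓ : ℕ} {K : Type} [Field K] {f : MvPolynomial (Fin ℓ) K}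
    {v w : Fin ℓ →₀ ℕ} (hv : IsLeadingMonomial f v) (hw : IsLeadingMonomial f w) : v = w := by
  by_contra hne
  exact (hv.2 w hw.1 (Ne.symm hne)).asymm (hw.2 v hv.1 hne)

section expScale

variable {ℓ : ℕ} (dv : Fin ℓ → ℕ)

@[simp]
theorem expScale_apply (v : Fin ℓ →₀ ℕ) (i : Fin ℓ) : expScale dv v i = dv i * v i := rfl

theorem expScale_sup (v w : Fin ℓ →₀ ℕ) :
    expScale dv (v ⊔ w) = expScale dv v ⊔ expScale dv w := by
  ext i
  simp [Nat.mul_max_mul_left]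

theorem expScale_tsub (v w : Fin ℓ →₀ ℕ) :
    expScale dv (v - w) = expScale dv v - expScale dv w := by
  ext i
  simp [Nat.mul_sub]

variable {dv}

theorem expScale_injective (hdv : ∀ i, 0 < dv i) : Function.Injective (expScale dv) := by
  intro v w hvw
  ext i
  exact Nat.eq_of_mul_eq_mul_left (hdv i) (DFunLike.congr_fun hvw i)

theorem LexLT.expScale (hdv : ∀ i, 0 < dv i) {v w : Fin ℓ →₀ ℕ} (hvw : LexLT v w) :
    LexLT (expScale dv v) (expScale dv w) := by
  obtain ⟨i, hi, hi'⟩ := hvw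
  exact ⟨i, Nat.mul_lt_mul_of_pos_left hi (hdv i), fun j hj => by simp [hi' j hj]⟩

end expScale

section powerMap

variable {ℓ : ℕ} {K : Type} [Field K] {dv : Fin ℓ → ℕ}

theorem aeval_X_pow_monomial (dv : Fin ℓ → ℕ) (v : Fin ℓ →₀ ℕ) (a : K) :
    aeval (fun i => (X i : MvPolynomial (Fin ℓ) K) ^ dv i) (monomial v a) =
      monomial (expScale dv v) a := by
  rw [aeval_monomial, monomial_eq, Finsupp.prod_fintype _ _ (by simp),
    Finsupp.prod_fintype _ _ (by simp)]
  simp [pow_mul, algebraMap_eq]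

theorem coeff_expScale_aeval_X_pow (hdv : ∀ i, 0 < dv i) (f : MvPolynomial (Fin ℓ) K)
    (v : Fin ℓ →₀ ℕ) :
    coeff (expScale dv v) (aeval (fun i => (X i : MvPolynomial (Fin ℓ) K) ^ dv i) f) =
      coeff v f := by
  classical
  induction f using MvPolynomial.induction_on' with
  | monomial u a =>
    rw [aeval_X_pow_monomial, coeff_monomial, coeff_monomial]
    simp only [(expScale_injective hdv).eq_iff]
  | add p q hp hq => rw [map_add, coeff_add, coeff_add, hp, hq]

theorem exists_expScale_eq_of_coeff_aeval_X_pow_ne_zero {f : MvPolynomial (Fin ℓ) K}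
    {w : Fin ℓ →₀ ℕ}
    (hw : coeff w (aeval (fun i => (X i : MvPolynomial (Fin ℓ) K) ^ dv i) f) ≠ 0) :
    ∃ v, expScale dv v = w := by
  classical
  induction f using MvPolynomial.induction_on' with
  | monomial u a =>
    rw [aeval_X_pow_monomial, coeff_monomial] at hw
    exact ⟨u, (ite_ne_right_iff.mp hw).1⟩
  | add p q hp hq =>
    by_cases h : coeff w (aeval (fun i => (X i : MvPolynomial (Fin ℓ) K) ^ dv i) p) = 0
    · rw [map_add, coeff_add, h, zero_add] at hw
      exact hq hw
    · exact hp h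

theorem IsLeadingMonomial.aeval_X_pow (hdv : ∀ i, 0 < dv i) {f : MvPolynomial (Fin ℓ) K}
    {v : Fin ℓ →₀ ℕ} (hv : IsLeadingMonomial f v) :
    IsLeadingMonomial (aeval (fun i => (X i : MvPolynomial (Fin ℓ) K) ^ dv i) f)
      (expScale dv v) := by
  refine ⟨?_, fun w hw hne => ?_⟩
  · rw [mem_support_iff, coeff_expScale_aeval_X_pow hdv]
    exact mem_support_iff.mp hv.1
  · obtain ⟨u, rfl⟩ := exists_expScale_eq_of_coeff_aeval_X_pow_ne_zero (mem_support_iff.mp hw)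
    rw [mem_support_iff, coeff_expScale_aeval_X_pow hdv] at hw
    exact (hv.2 u (mem_support_iff.mpr hw) fun h => hne (congrArg _ h)).expScale hdv

end powerMap

/-- For the `K`-algebra map `φ : S → S` with `φ(x_i) = x_i^{d_i}` (`d_i > 0`) and the
lexicographic order with `x_ℓ > … > x_1`, the S-polynomials of nonzero polynomials satisfy
`φ(S(f,h)) = S(φ(f), φ(h))`.  Here `v, w` are the exponent vectors of the leading monomials
of `f, h`, and `v', w'` those of the leading monomials of `φ(f), φ(h)`. -/
theorem sPoly_of_power_map {ℓ : ℕ} {K : Type} [Field K]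
    (dv : Fin ℓ → ℕ) (hdv : ∀ i, 0 < dv i)
    (f h : MvPolynomial (Fin ℓ) K) (hf : f ≠ 0) (hh : h ≠ 0)
    (v w : Fin ℓ →₀ ℕ) (hv : IsLeadingMonomial f v) (hw : IsLeadingMonomial h w)
    (v' w' : Fin ℓ →₀ ℕ)
    (hv' : IsLeadingMonomial
      ((aeval (fun i => (X i : MvPolynomial (Fin ℓ) K) ^ dv i) :
        MvPolynomial (Fin ℓ) K →ₐ[K] MvPolynomial (Fin ℓ) K) f) v')
    (hw' : IsLeadingMonomial
      ((aeval (fun i => (X i : MvPolynomial (Fin ℓ) K) ^ dv i) :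
        MvPolynomial (Fin ℓ) K →ₐ[K] MvPolynomial (Fin ℓ) K) h) w') :
    (aeval (fun i => (X i : MvPolynomial (Fin ℓ) K) ^ dv i) :
        MvPolynomial (Fin ℓ) K →ₐ[K] MvPolynomial (Fin ℓ) K) (sPoly f h v w) =
      sPoly
        ((aeval (fun i => (X i : MvPolynomial (Fin ℓ) K) ^ dv i) :
          MvPolynomial (Fin ℓ) K →ₐ[K] MvPolynomial (Fin ℓ) K) f)
        ((aeval (fun i => (X i : MvPolynomial (Fin ℓ) K) ^ dv i) :
          MvPolynomial (Fin ℓ) K →ₐ[K] MvPolynomial (Fin ℓ) K) h) v' w' := by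
  obtain rfl := (hv.aeval_X_pow hdv).unique hv'
  obtain rfl := (hw.aeval_X_pow hdv).unique hw'
  simp only [sPoly, map_sub, map_mul, aeval_X_pow_monomial, coeff_expScale_aeval_X_pow hdv,
    expScale_sup, expScale_tsub]
end
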